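/- arXiv:2006.11701 — 16 statements merged into one kernel-verified Lean document; each statement's English description precedes it below -/
import Mathlib

section
/- Let p be a prime and let r, s ∈ {0, 1, ..., p-1} with s > r. Then the pair (r, s) does not satisfy the Lucas congruence modulo p²; in fact, with a = 1 and b = 0 one has C(p·1 + r, p·0 + s) ≢ C(1,0)·C(r,s) (mod p²). -/
/-- For a prime p and digits r, s with s > r, the Lucas congruence
modulo p² fails at a = 1, b = 0. -/
theorem lucas_mod_p_sq_fails_of_lt (p : ℕ) (hp : p.Prime) (r s : ℕ)
    (hr : r < p) (hs : s < p) (hsr : r < s) :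
    ¬ ((p * 1 + r).choose (p * 0 + s) ≡ Nat.choose 1 0 * r.choose s [MOD p ^ 2]) := by
  rw [Nat.choose_eq_zero_of_lt hsr, mul_zero, mul_one, mul_zero, zero_add,
    Nat.modEq_zero_iff_dvd]
  intro h
  have hlt : p + r < p ^ 2 := by nlinarith [hp.two_le]
  have hle := Nat.factorization_choose_le_one (p := p) (n := p + r) (k := s) hlt
  have hne : (p + r).choose s ≠ 0 := (Nat.choose_pos (by omega)).ne'
  have := (hp.pow_dvd_iff_le_factorization hne).1 h
  omega
end

section
/- Let p be a prime and let r, s ∈ {0, 1, ..., p-1} with s > r. Then the binomial coefficient C(p + r, s) is divisible by p but not by p². -/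
/-- For a prime p and digits r, s with s > r, the binomial coefficient
C(p + r, s) is divisible by p but not by p². -/
theorem choose_p_add_dvd_not_sq (p : ℕ) (hp : p.Prime) (r s : ℕ)
    (hr : r < p) (hs : s < p) (hsr : r < s) :
    p ∣ (p + r).choose s ∧ ¬ p ^ 2 ∣ (p + r).choose s := by
  refine ⟨hp.dvd_choose hs (by omega) (by omega), fun h => ?_⟩
  have hlt : p + r < p ^ 2 := by nlinarith [hp.two_le]
  have hle : ((p + r).choose s).factorization p ≤ 1 :=
    Nat.factorization_choose_le_one hlt
  have hne : (p + r).choose s ≠ 0 := (Nat.choose_pos (by omega)).ne'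
  have := (hp.pow_dvd_iff_le_factorization hne).1 h
  omega
end

section
/- Let p be a prime and let r, s ∈ {0, 1, ..., p-1}. The congruence C(p·a + r, p·b + s) ≡ C(a,b)·C(r,s) (mod p²) holds for all integers a ≥ 0 and b ≥ 0 if and only if s ≤ r and C(r,s) ≡ (-1)^{r-s}·C(p-1-s, r-s) ≡ (-1)^s·C(p-1-r+s, s) (mod p²). -/
open Polynomial in
/-- If `p² = 0` in `R`, the powers of `(1 + X)ᵖ` satisfy the linear recurrence with characteristic
polynomial `(T - (1 + Xᵖ))²`. -/
theorem one_add_X_pow_add_two_mul {R : Type*} [CommRing R] {p : ℕ} (hp : p.Prime)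
    (h0 : (p : R) ^ 2 = 0) (n : ℕ) :
    (1 + X : R[X]) ^ (n + 2 * p) =
      2 * (1 + X) ^ (n + p) - (1 + X) ^ n + X ^ p * (2 * (1 + X) ^ (n + p) - 2 * (1 + X) ^ n)
        - X ^ (2 * p) * (1 + X) ^ n := by
  obtain ⟨F, hF⟩ := exists_add_pow_prime_eq hp (1 : R[X]) X
  have h : (p : R[X]) ^ 2 = 0 := by
    have := congrArg (C : R → R[X]) h0
    simpa using this
  have e : (1 + X : R[X]) ^ (n + 2 * p) = (1 + X) ^ n * ((1 + X) ^ p) ^ 2 := by ring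
  rw [e, pow_add _ n p, hF]
  linear_combination (1 + X : R[X]) ^ n * X ^ 2 * F ^ 2 * h

open Polynomial in
theorem cast_choose_add_two_mul {R : Type*} [CommRing R] {p : ℕ} (hp : p.Prime)
    (h0 : (p : R) ^ 2 = 0) (n k : ℕ) :
    ((n + 2 * p).choose k : R) =
      2 * ((n + p).choose k : R) - n.choose k
        + (if p ≤ k then 2 * ((n + p).choose (k - p) : R) - 2 * (n.choose (k - p) : R) else 0)
        - (if 2 * p ≤ k then (n.choose (k - 2 * p) : R) else 0) := by
  have h := congrArg (fun q => coeff q k) (one_add_X_pow_add_two_mul hp h0 n)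
  have h2 : (2 : R[X]) = C 2 := (map_ofNat C 2).symm
  simpa only [h2, coeff_add, coeff_sub, coeff_X_pow_mul', coeff_C_mul, coeff_one_add_X_pow] using h

/-- If `p² = 0` in `R`, the Lucas congruence for the digits `(r, s)` follows from its instances
`(a, b) = (1, 0)` and `(a, b) = (1, 1)`. -/
theorem cast_choose_mul_add {R : Type*} [CommRing R] {p r s : ℕ} (hp : p.Prime)
    (h0 : (p : R) ^ 2 = 0) (hr : r < p) (hs : s < p)
    (h1 : ((p + r).choose s : R) = r.choose s) (h2 : ((p + r).choose (p + s) : R) = r.choose s)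
    (a b : ℕ) : ((p * a + r).choose (p * b + s) : R) = a.choose b * r.choose s := by
  induction a using Nat.twoStepInduction generalizing b with
  | zero =>
    rcases b with _ | b
    · simp
    · rw [Nat.choose_eq_zero_of_lt (by nlinarith : p * 0 + r < p * (b + 1) + s)]
      simp
  | one =>
    rcases b with _ | _ | b
    · simpa using h1
    · simpa using h2
    · rw [Nat.choose_eq_zero_of_lt (by nlinarith : p * 1 + r < p * (b + 1 + 1) + s)]
      simp [Nat.choose_eq_zero_of_lt]
  | more a iha ihb =>
    have e2 : p * (a + 2) + r = p * a + r + 2 * p := by ring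
    have e1 : p * (a + 1) + r = p * a + r + p := by ring
    simp only [e1] at ihb
    rw [e2, cast_choose_add_two_mul hp h0, ihb, iha]
    rcases b with _ | _ | b
    · rw [if_neg (by omega), if_neg (by omega)]
      simp
      ring
    · have e3 : p * (0 + 1) + s - p = p * 0 + s := by
        simp
      rw [if_pos (by omega), if_neg (by omega), e3, ihb, iha]
      simp
      ring
    · have e3 : p * (b + 1 + 1) + s - p = p * (b + 1) + s := by
        rw [Nat.sub_eq_iff_eq_add (by nlinarith)]; ring
      have e4 : p * (b + 1 + 1) + s - 2 * p = p * b + s := by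
        rw [Nat.sub_eq_iff_eq_add (by nlinarith)]; ring
      rw [if_pos (by nlinarith), if_pos (by nlinarith), e3, e4, ihb, iha, iha]
      simp only [Nat.choose_succ_succ' (a + 1), Nat.choose_succ_succ' a]
      push_cast
      ring

theorem exists_prod_add_and_prod_sub {ι R : Type*} [CommRing R] (t : R) (ht : t ^ 2 = 0)
    (S : Finset ι) (x : ι → R) :
    ∃ c, ∏ i ∈ S, (x i + t) = ∏ i ∈ S, x i + c * t ∧
      ∏ i ∈ S, (x i - t) = ∏ i ∈ S, x i - c * t := by
  classical
  induction S using Finset.induction_on with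
  | empty => exact ⟨0, by simp⟩
  | insert i S hi ih =>
    obtain ⟨c, h1, h2⟩ := ih
    refine ⟨∏ j ∈ S, x j + x i * c, ?_, ?_⟩
    · rw [Finset.prod_insert hi, Finset.prod_insert hi, h1]
      linear_combination c * ht
    · rw [Finset.prod_insert hi, Finset.prod_insert hi, h2]
      linear_combination c * ht

theorem cast_factorial_mul_choose {R : Type*} [CommRing R] {n k : ℕ} (h : k ≤ n) :
    (k.factorial : R) * n.choose k = ∏ i ∈ Finset.range k, ((n : R) - i) := by
  rw [← Nat.cast_mul, ← Nat.descFactorial_eq_factorial_mul_choose,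
    Nat.descFactorial_eq_prod_range, Nat.cast_prod]
  refine Finset.prod_congr rfl fun i hi => ?_
  have := Finset.mem_range.mp hi
  rw [Nat.cast_sub (by omega)]

/-- If `p² = 0` in `R`, the values of `C(x, s)` at `x = r + p`, `r` and `r - p` are in arithmetic
progression. -/
theorem cast_choose_add_neg_one_pow_mul_choose {R : Type*} [CommRing R] {p r s : ℕ}
    (h0 : (p : R) ^ 2 = 0) (hr : r < p) (hsr : s ≤ r) (hu : IsUnit (s.factorial : R)) :
    ((p + r).choose s : R) + (-1) ^ s * ((p - 1 - r + s).choose s : R) = 2 * r.choose s := by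
  obtain ⟨c, h1, h2⟩ :=
    exists_prod_add_and_prod_sub (p : R) h0 (Finset.range s) (fun i => (r : R) - i)
  rw [← cast_factorial_mul_choose hsr] at h1 h2
  have h3 := cast_factorial_mul_choose (R := R) (show s ≤ p + r by omega)
  have h4 := cast_factorial_mul_choose (R := R) (show s ≤ p - 1 - r + s by omega)
  have h5 : ∏ i ∈ Finset.range s, (((p + r : ℕ) : R) - i) =
      ∏ i ∈ Finset.range s, ((r : R) - i + p) :=
    Finset.prod_congr rfl fun i _ => by push_cast; ring
  have h6 : ∏ i ∈ Finset.range s, ((r : R) - i - p) =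
      (-1) ^ s * ∏ i ∈ Finset.range s, (((p - 1 - r + s : ℕ) : R) - i) := by
    rw [← Finset.prod_range_reflect (fun i => ((p - 1 - r + s : ℕ) : R) - i) s]
    conv_rhs => rw [← Finset.card_range s, ← Finset.prod_const, Finset.card_range,
      ← Finset.prod_mul_distrib]
    refine Finset.prod_congr rfl fun i hi => ?_
    have hi := Finset.mem_range.mp hi
    have e : ((p - 1 - r + s : ℕ) : R) - ((s - 1 - i : ℕ) : R) = p - r + i := by
      rw [← Nat.cast_sub (by omega), show p - 1 - r + s - (s - 1 - i) = p - r + i by omega,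
        Nat.cast_add, Nat.cast_sub hr.le]
    rw [e]
    ring
  refine hu.mul_left_cancel ?_
  linear_combination h3 + (-1) ^ s * h4 + h5 - h6 + h1 + h2


/-- The Lucas congruence modulo p² holds for the digit pair (r, s) for all
a, b ≥ 0 if and only if s ≤ r and
C(r,s) ≡ (-1)^(r-s)·C(p-1-s, r-s) ≡ (-1)^s·C(p-1-r+s, s) (mod p²). -/
theorem lucas_mod_p_sq_iff (p : ℕ) (hp : p.Prime) (r s : ℕ) (hr : r < p) (hs : s < p) :
    (∀ a b : ℕ, (p * a + r).choose (p * b + s) ≡ a.choose b * r.choose s [MOD p ^ 2]) ↔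
      (s ≤ r ∧
        ((r.choose s : ℤ) ≡ (-1) ^ (r - s) * ((p - 1 - s).choose (r - s) : ℤ)
          [ZMOD (p : ℤ) ^ 2]) ∧
        ((-1 : ℤ) ^ (r - s) * ((p - 1 - s).choose (r - s) : ℤ) ≡
          (-1) ^ s * ((p - 1 - r + s).choose s : ℤ) [ZMOD (p : ℤ) ^ 2])) := by
  have h0 : (p : ZMod (p ^ 2)) ^ 2 = 0 := by
    rw [← Nat.cast_pow, ZMod.natCast_self]
  have hu : ∀ k ≤ r, IsUnit (k.factorial : ZMod (p ^ 2)) := fun k hk => by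
    rw [ZMod.isUnit_iff_coprime]
    exact (Nat.coprime_pow_right_iff two_pos _ _).mpr
      ((hp.coprime_iff_not_dvd.mpr (by rw [hp.dvd_factorial]; omega)).symm)
  have modEq_iff (x y : ℤ) : x ≡ y [ZMOD (p : ℤ) ^ 2] ↔ (x : ZMod (p ^ 2)) = y := by
    rw [ZMod.intCast_eq_intCast_iff, Nat.cast_pow]
  simp only [modEq_iff, ← ZMod.natCast_eq_natCast_iff]
  push_cast
  have key (hsr : s ≤ r) :
      ((p + r).choose s : ZMod (p ^ 2)) + (-1) ^ s * ((p - 1 - r + s).choose s : ZMod (p ^ 2)) =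
          2 * r.choose s ∧
        ((p + r).choose (p + s) : ZMod (p ^ 2)) +
          (-1) ^ (r - s) * ((p - 1 - s).choose (r - s) : ZMod (p ^ 2)) = 2 * r.choose s := by
    refine ⟨cast_choose_add_neg_one_pow_mul_choose h0 hr hsr (hu s hsr), ?_⟩
    have h := cast_choose_add_neg_one_pow_mul_choose h0 hr (Nat.sub_le r s) (hu _ (Nat.sub_le r s))
    rwa [Nat.choose_symm hsr, show p - 1 - r + (r - s) = p - 1 - s by omega,
      ← Nat.choose_symm (show r - s ≤ p + r by omega),
      show p + r - (r - s) = p + s by omega] at h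
  constructor
  · intro h
    have h1 := h 1 0
    have h2 := h 1 1
    simp only [mul_one, mul_zero, zero_add, Nat.choose_zero_right, Nat.choose_self, Nat.cast_one,
      one_mul] at h1 h2
    have hsr : s ≤ r := by
      by_contra! hlt
      rw [Nat.choose_eq_zero_of_lt hlt, Nat.cast_zero, ZMod.natCast_eq_zero_iff,
        hp.pow_dvd_iff_le_factorization (Nat.choose_pos (by omega)).ne'] at h1
      have := Nat.factorization_choose_le_one (p := p) (n := p + r) (k := s)
        (by nlinarith [hp.two_le])
      omega
    obtain ⟨k1, k2⟩ := key hsr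
    exact ⟨hsr, by linear_combination h2 - k2, by linear_combination k2 - h2 - k1 + h1⟩
  · rintro ⟨hsr, h1, h2⟩ a b
    obtain ⟨k1, k2⟩ := key hsr
    exact cast_choose_mul_add hp h0 hr hs (by linear_combination k1 + h1 + h2)
      (by linear_combination k2 + h1) a b
end

section
/- Let p be a prime with p ≡ 1 (mod 3). Then for all integers a ≥ 0 and b ≥ 0, C(p·a + (2/3)(p-1), p·b + (1/3)(p-1)) ≡ C(a,b)·C((2/3)(p-1), (1/3)(p-1)) (mod p²). -/
open Finset in
theorem exists_prod_add_eq_of_mul_self_eq_zero {ι R : Type*} [CommRing R] {t : R}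
    (ht : t * t = 0) (s : Finset ι) (f : ι → R) :
    ∃ d, ∀ x, ∏ i ∈ s, (t * x + f i) = ∏ i ∈ s, f i + t * x * d := by
  classical
  induction s using Finset.induction_on with
  | empty => exact ⟨0, by simp⟩
  | insert i s hi ih =>
    obtain ⟨d, hd⟩ := ih
    refine ⟨∏ j ∈ s, f j + f i * d, fun x => ?_⟩
    rw [prod_insert hi, prod_insert hi, hd]
    linear_combination x * x * d * ht

theorem natCast_mul_self_zmod_sq (p : ℕ) : (p : ZMod (p ^ 2)) * p = 0 := by
  rw [← sq]
  exact_mod_cast ZMod.natCast_self (p ^ 2)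

theorem natCast_ascFactorial_mul_add_add_one {R : Type*} [CommRing R] (p x n m : ℕ) :
    ((p * x + n + 1).ascFactorial m : R) =
      ∏ i ∈ Finset.range m, ((p : R) * x + (n + 1 + i)) := by
  rw [Nat.ascFactorial_eq_prod_range]
  push_cast
  exact Finset.prod_congr rfl fun i _ => by ring

theorem ascFactorial_mul_add_zmod_sq_of_symm {p n m : ℕ} (hm : Even m) (hp : 2 * n + m + 1 = p)
    (x : ℕ) :
    ((p * x + n + 1).ascFactorial m : ZMod (p ^ 2)) = (n + 1).ascFactorial m := by
  obtain ⟨d, hd⟩ := exists_prod_add_eq_of_mul_self_eq_zero (natCast_mul_self_zmod_sq p)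
    (Finset.range m) (fun i => ((n : ZMod (p ^ 2)) + 1 + i))
  have hsymm : ∏ i ∈ Finset.range m, ((p : ZMod (p ^ 2)) * (-1) + (n + 1 + i)) =
      ∏ i ∈ Finset.range m, ((n : ZMod (p ^ 2)) + 1 + i) := by
    rw [← Finset.prod_range_reflect]
    calc
      _ = ∏ i ∈ Finset.range m, -((n : ZMod (p ^ 2)) + 1 + i) := by
        refine Finset.prod_congr rfl fun i hi => ?_
        obtain ⟨j, rfl⟩ : ∃ j, m = i + 1 + j :=
          Nat.exists_eq_add_of_le (Finset.mem_range.mp hi)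
        have hj : i + 1 + j - 1 - i = j := by lia
        have hp' := congrArg (Nat.cast (R := ZMod (p ^ 2))) hp
        push_cast at hp'
        rw [hj]
        linear_combination hp'
      _ = _ := by rw [Finset.prod_neg, Finset.card_range, hm.neg_one_pow, one_mul]
  have hd₀ := hd (-1)
  rw [hsymm] at hd₀
  have h₀ := natCast_ascFactorial_mul_add_add_one (R := ZMod (p ^ 2)) p 0 n m
  rw [natCast_ascFactorial_mul_add_add_one, hd]
  simp only [mul_zero, zero_add, Nat.cast_zero] at h₀
  rw [h₀]
  linear_combination x * hd₀

theorem isUnit_natCast_factorial_zmod_sq {p k : ℕ} (hp : p.Prime) (hk : k < p) :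
    IsUnit (k.factorial : ZMod (p ^ 2)) := by
  rw [ZMod.isUnit_iff_coprime]
  exact ((hp.coprime_iff_not_dvd.mpr (by rw [hp.dvd_factorial]; lia)).symm).pow_right 2

theorem ascFactorial_mul_add_one_zmod_sq_mul (p b c k : ℕ) :
    ((p * b + 1).ascFactorial k * (p * c + 1).ascFactorial k : ZMod (p ^ 2)) =
      (p * (b + c) + 1).ascFactorial k * k.factorial := by
  have ht := natCast_mul_self_zmod_sq p
  obtain ⟨d, hd⟩ := exists_prod_add_eq_of_mul_self_eq_zero ht
    (Finset.range k) (fun i => ((0 : ℕ) : ZMod (p ^ 2)) + 1 + i)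
  have h (x : ℕ) := (natCast_ascFactorial_mul_add_add_one p x 0 k).trans (hd x)
  simp only [add_zero] at h
  have h₀ := h 0
  rw [mul_zero, zero_add, Nat.one_ascFactorial] at h₀
  rw [h b, h c, h (b + c), h₀]
  push_cast
  linear_combination (b * c * d * d) * ht

theorem factorial_mul_eq_pow_mul_prod {p : ℕ} (hp : 0 < p) (a : ℕ) :
    (p * a).factorial = p ^ a * a.factorial *
      ∏ x ∈ Finset.range a, (p * x + 1).ascFactorial (p - 1) := by
  induction a with
  | zero => simp
  | succ a ih =>
    obtain ⟨q, rfl⟩ := Nat.exists_eq_add_of_le' hp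
    rw [mul_add, mul_one, ← Nat.factorial_mul_ascFactorial, ih, Finset.prod_range_succ,
      Nat.add_sub_cancel, Nat.ascFactorial_succ, Nat.factorial_succ]
    ring

theorem choose_mul_mul_modEq_choose_sq {p : ℕ} (hp : p.Prime) (hodd : Odd p) (a b : ℕ) :
    (p * a).choose (p * b) ≡ a.choose b [MOD p ^ 2] := by
  rcases lt_or_ge a b with hab | hab
  · rw [Nat.choose_eq_zero_of_lt hab, Nat.choose_eq_zero_of_lt (by gcongr; exact hp.pos)]
  obtain ⟨c, rfl⟩ := Nat.exists_eq_add_of_le hab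
  have hprod (n : ℕ) : ((∏ x ∈ Finset.range n, (p * x + 1).ascFactorial (p - 1) : ℕ) :
      ZMod (p ^ 2)) = ((p - 1).factorial : ZMod (p ^ 2)) ^ n := by
    have hm : Even (p - 1) := Nat.Odd.sub_odd hodd odd_one
    have hpm : 2 * 0 + (p - 1) + 1 = p := by have := hp.pos; lia
    have h := ascFactorial_mul_add_zmod_sq_of_symm hm hpm
    simp only [add_zero, zero_add, Nat.one_ascFactorial] at h
    rw [Nat.cast_prod, Finset.prod_congr rfl fun x _ => h x, Finset.prod_const, Finset.card_range]
  have hnat : (p * (b + c)).choose (p * b) *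
      ((∏ x ∈ Finset.range b, (p * x + 1).ascFactorial (p - 1)) *
        ∏ x ∈ Finset.range c, (p * x + 1).ascFactorial (p - 1)) =
      (b + c).choose b * ∏ x ∈ Finset.range (b + c), (p * x + 1).ascFactorial (p - 1) := by
    have h₁ := Nat.add_choose_mul_factorial_mul_factorial (p * b) (p * c)
    have h₂ := Nat.add_choose_mul_factorial_mul_factorial b c
    rw [← Nat.choose_symm_add] at h₁ h₂
    rw [← mul_add] at h₁
    simp only [factorial_mul_eq_pow_mul_prod hp.pos] at h₁
    have hpos : 0 < p ^ (b + c) * (b.factorial * c.factorial) := by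
      have := hp.pos
      positivity
    apply Nat.eq_of_mul_eq_mul_left hpos
    rw [← h₂, pow_add] at h₁
    rw [pow_add]
    linarith
  rw [← ZMod.natCast_eq_natCast_iff]
  have hcast := congrArg (Nat.cast (R := ZMod (p ^ 2))) hnat
  simp only [Nat.cast_mul, hprod, ← pow_add] at hcast
  exact ((isUnit_natCast_factorial_zmod_sq hp (Nat.sub_one_lt hp.ne_zero)).pow _).mul_right_cancel
    hcast

theorem add_choose_mul_ascFactorial_mul_ascFactorial (m n k l : ℕ) :
    ((m + k) + (n + l)).choose (m + k) * ((m + 1).ascFactorial k * (n + 1).ascFactorial l) =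
      (m + n).choose m * (m + n + 1).ascFactorial (k + l) := by
  have h₁ := Nat.add_choose_mul_factorial_mul_factorial (m + k) (n + l)
  have h₂ := Nat.add_choose_mul_factorial_mul_factorial m n
  rw [← Nat.choose_symm_add] at h₁ h₂
  rw [show m + k + (n + l) = m + n + (k + l) by ring] at h₁ ⊢
  rw [← Nat.factorial_mul_ascFactorial m, ← Nat.factorial_mul_ascFactorial n,
    ← Nat.factorial_mul_ascFactorial (m + n), ← h₂] at h₁
  apply Nat.eq_of_mul_eq_mul_left (Nat.mul_pos m.factorial_pos n.factorial_pos)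
  linarith

/-- If p ≡ 1 (mod 3), then the Lucas congruence modulo p² holds for the
digit pair (2(p-1)/3, (p-1)/3) for all a, b ≥ 0. -/
theorem lucas_mod_p_sq_center (p : ℕ) (hp : p.Prime) (hp3 : p % 3 = 1) (a b : ℕ) :
    (p * a + 2 * (p - 1) / 3).choose (p * b + (p - 1) / 3) ≡
      a.choose b * ((2 * (p - 1) / 3).choose ((p - 1) / 3)) [MOD p ^ 2] := by
  obtain ⟨k, hk⟩ : ∃ k, p = 3 * k + 1 := ⟨p / 3, by lia⟩
  have hodd : Odd p := hp.odd_of_ne_two (by lia)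
  have hkeven : Even k := by
    rw [hk] at hodd
    grind
  rw [show 2 * (p - 1) / 3 = k + k by lia, show (p - 1) / 3 = k by lia]
  rcases lt_or_ge a b with hab | hab
  · have hlt : p * a + (k + k) < p * b + k := by
      have := Nat.mul_le_mul_left p (Nat.succ_le_of_lt hab)
      lia
    rw [Nat.choose_eq_zero_of_lt hab, Nat.choose_eq_zero_of_lt hlt, zero_mul]
  obtain ⟨c, rfl⟩ := Nat.exists_eq_add_of_le hab
  have hchoose := choose_mul_mul_modEq_choose_sq hp hodd (b + c) b
  rw [← ZMod.natCast_eq_natCast_iff] at hchoose ⊢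
  have hnat := congrArg (Nat.cast (R := ZMod (p ^ 2)))
    (add_choose_mul_ascFactorial_mul_ascFactorial (p * b) (p * c) k k)
  have hcentral := congrArg (Nat.cast (R := ZMod (p ^ 2)))
    (add_choose_mul_ascFactorial_mul_ascFactorial 0 0 k k)
  have hsymm := ascFactorial_mul_add_zmod_sq_of_symm hkeven (by lia : 2 * k + k + 1 = p) (b + c)
  rw [← mul_add, ← Nat.ascFactorial_mul_ascFactorial, add_right_comm _ 1 k] at hnat
  rw [← Nat.ascFactorial_mul_ascFactorial] at hcentral
  simp only [zero_add, Nat.one_ascFactorial, Nat.choose_self, one_mul, add_comm 1 k,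
    Nat.cast_mul] at hcentral
  simp only [Nat.cast_mul, hsymm, ascFactorial_mul_add_one_zmod_sq_mul, hchoose] at hnat
  have hunit := isUnit_natCast_factorial_zmod_sq hp (by lia : k < p)
  have hunit' : IsUnit ((p * (b + c) + 1).ascFactorial k : ZMod (p ^ 2)) := by
    rw [ZMod.isUnit_iff_coprime, Nat.ascFactorial_eq_prod_range]
    refine Nat.Coprime.pow_right 2 (Nat.Coprime.prod_left fun i hi => ?_)
    have := Finset.mem_range.mp hi
    rw [add_assoc, Nat.coprime_mul_left_add_left]
    exact (Nat.coprime_of_lt_prime (by lia) (by lia) hp).symm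
  rw [show p * (b + c) + (k + k) = p * b + k + (p * c + k) by ring, Nat.cast_mul]
  apply (hunit'.mul (hunit.mul hunit)).mul_right_cancel
  linear_combination k.factorial * hnat -
    (b + c).choose b * (p * (b + c) + 1).ascFactorial k * hcentral
end

section
/- Let p be a prime with p ≡ 1 (mod 3) and let ℓ ≥ 0 be an integer. Then C((2/3)(p^ℓ - 1), (1/3)(p^ℓ - 1)) ≡ C((2/3)(p-1), (1/3)(p-1))^ℓ (mod p²). -/
/-- The product `(x + 1) (x + 2) ⋯ (x + r)`. -/
def shiftedFactorial {R : Type*} [CommRing R] (r : ℕ) (x : R) : R :=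
  ∏ i ∈ Finset.range r, (x + i + 1)

section CommRing

variable {R : Type*} [CommRing R]

theorem shiftedFactorial_succ (r : ℕ) (x : R) :
    shiftedFactorial (r + 1) x = shiftedFactorial r x * (x + r + 1) :=
  Finset.prod_range_succ _ _

theorem shiftedFactorial_zero_right (r : ℕ) : shiftedFactorial r (0 : R) = (r.factorial : R) := by
  simp [shiftedFactorial, ← Finset.prod_range_add_one_eq_factorial]

theorem shiftedFactorial_add (a b : ℕ) (x : R) :
    shiftedFactorial (a + b) x = shiftedFactorial a x * shiftedFactorial b (x + a) := by
  simp only [shiftedFactorial, Finset.prod_range_add, Nat.cast_add, add_assoc]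

theorem shiftedFactorial_reflect (r : ℕ) (x : R) :
    shiftedFactorial r x = (-1) ^ r * shiftedFactorial r (-x - (r + 1)) := by
  unfold shiftedFactorial
  rw [← Finset.prod_range_reflect, ← Finset.card_range r, ← Finset.prod_const, Finset.card_range,
    ← Finset.prod_mul_distrib]
  refine Finset.prod_congr rfl fun i hi => ?_
  have h : i + 1 ≤ r := Finset.mem_range.mp hi
  rw [Nat.sub_sub, add_comm 1 i, Nat.cast_sub h]
  push_cast
  ring

/-- Taylor expansion of the shifted factorial at a square-zero element. -/
theorem exists_shiftedFactorial_mul_eq {e : R} (he : e ^ 2 = 0) (r : ℕ) :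
    ∃ d : R, ∀ a : R, shiftedFactorial r (a * e) = r.factorial + a * (e * d) := by
  induction r with
  | zero => exact ⟨0, fun a => by simp [shiftedFactorial]⟩
  | succ r ih =>
    obtain ⟨d, hd⟩ := ih
    refine ⟨d * (r + 1) + r.factorial, fun a => ?_⟩
    rw [shiftedFactorial_succ, hd, Nat.factorial_succ]
    push_cast
    linear_combination a ^ 2 * d * he

theorem shiftedFactorial_mul_of_even {e : R} (he : e ^ 2 = 0) {r : ℕ} (hr : Even r)
    (hre : (r : R) + 1 = e) (a : R) : shiftedFactorial r (a * e) = r.factorial := by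
  obtain ⟨d, hd⟩ := exists_shiftedFactorial_mul_eq he r
  have h := shiftedFactorial_reflect r (0 : R)
  rw [hre, hr.neg_one_pow, one_mul, shiftedFactorial_zero_right,
    show -(0 : R) - e = -1 * e by ring, hd] at h
  rw [hd]
  linear_combination a * h

theorem shiftedFactorial_two_mul_mul {e : R} (he : e ^ 2 = 0) {m : ℕ} (hm : Even m)
    (hme : (3 * m : R) + 1 = e) (a : R) :
    shiftedFactorial (2 * m) (a * e) * shiftedFactorial m (-(a + 1) * e) =
      (3 * m).factorial := by
  rw [← shiftedFactorial_mul_of_even he (hm.mul_left 3) (by push_cast; exact hme) a,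
    show 3 * m = 2 * m + m by ring, shiftedFactorial_add,
    shiftedFactorial_reflect m (a * e + (2 * m : ℕ)), hm.neg_one_pow, one_mul]
  congr 2
  push_cast
  linear_combination hme

theorem shiftedFactorial_sq_mul {e : R} (he : e ^ 2 = 0) (m : ℕ) (a : R) :
    shiftedFactorial m (a * e) ^ 2 * shiftedFactorial m (-(2 * a + 1) * e) =
      shiftedFactorial m (-1 * e) * m.factorial ^ 2 := by
  obtain ⟨d, hd⟩ := exists_shiftedFactorial_mul_eq he m
  simp only [hd]
  linear_combination
    (a ^ 2 * d ^ 2 * (m.factorial - (2 * a + 1) * (e * d)) -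
      2 * a * (2 * a + 1) * d ^ 2 * m.factorial) * he

end CommRing

theorem factorial_add_eq_mul_prod (k r : ℕ) :
    (k + r).factorial = k.factorial * ∏ i ∈ Finset.range r, (k + i + 1) := by
  induction r with
  | zero => simp
  | succ r ih => rw [← add_assoc, Nat.factorial_succ, ih, Finset.prod_range_succ]; ring

theorem factorial_succ_mul (q N : ℕ) :
    ((q + 1) * N).factorial = (q + 1) ^ N * N.factorial *
      ∏ j ∈ Finset.range N, ∏ i ∈ Finset.range q, ((q + 1) * j + i + 1) := by
  induction N with
  | zero => simp
  | succ N ih =>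
    rw [show (q + 1) * (N + 1) = (q + 1) * N + q + 1 by ring, Nat.factorial_succ,
      factorial_add_eq_mul_prod, ih, Finset.prod_range_succ _ N, Nat.factorial_succ]
    ring

theorem factorial_two_mul (k : ℕ) :
    (2 * k).factorial = k.centralBinom * k.factorial ^ 2 := by
  rw [Nat.centralBinom, two_mul, ← Nat.add_choose_mul_factorial_mul_factorial k k]
  ring

theorem centralBinom_mul_prod_eq (q n m : ℕ) :
    ((q + 1) * n + m).centralBinom *
      ((∏ j ∈ Finset.range n, ∏ i ∈ Finset.range q, ((q + 1) * j + i + 1)) ^ 2 *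
        (∏ i ∈ Finset.range m, ((q + 1) * n + i + 1)) ^ 2) =
    n.centralBinom *
      ((∏ j ∈ Finset.range (2 * n), ∏ i ∈ Finset.range q, ((q + 1) * j + i + 1)) *
        ∏ i ∈ Finset.range (2 * m), ((q + 1) * (2 * n) + i + 1)) := by
  have h := factorial_two_mul ((q + 1) * n + m)
  rw [show 2 * ((q + 1) * n + m) = (q + 1) * (2 * n) + 2 * m by ring,
    factorial_add_eq_mul_prod, factorial_add_eq_mul_prod, factorial_succ_mul q (2 * n),
    factorial_succ_mul q n, factorial_two_mul] at h
  have hpos : 0 < (q + 1) ^ (2 * n) * n.factorial ^ 2 := by positivity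
  apply Nat.eq_of_mul_eq_mul_left hpos
  rw [pow_mul'] at h ⊢
  linarith

theorem centralBinom_mul_add_modEq {p m : ℕ} (hp : p.Prime) (hpm : p = 3 * m + 1) (n : ℕ) :
    (p * n + m).centralBinom ≡ n.centralBinom * m.centralBinom [MOD p ^ 2] := by
  rw [← ZMod.natCast_eq_natCast_iff]
  have hm : Even m := by
    rcases hp.eq_two_or_odd with h | h
    · omega
    · rw [Nat.even_iff]; omega
  have he : (p : ZMod (p ^ 2)) ^ 2 = 0 := by exact_mod_cast ZMod.natCast_self (p ^ 2)
  have hme : (3 * m : ZMod (p ^ 2)) + 1 = p := by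
    exact_mod_cast congrArg (Nat.cast : ℕ → ZMod (p ^ 2)) hpm.symm
  have isUnit_factorial {k : ℕ} (hk : k < p) : IsUnit (k.factorial : ZMod (p ^ 2)) := by
    rw [ZMod.isUnit_iff_coprime]
    exact (hp.coprime_factorial_of_lt hk).symm.pow_right 2
  have cast_prod (r k : ℕ) : ((∏ i ∈ Finset.range r, (p * k + i + 1) : ℕ) : ZMod (p ^ 2)) =
      shiftedFactorial r ((k : ZMod (p ^ 2)) * p) := by
    simp [shiftedFactorial, mul_comm]
  have cast_block (k : ℕ) :
      ((∏ i ∈ Finset.range (3 * m), (p * k + i + 1) : ℕ) : ZMod (p ^ 2)) =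
        (3 * m).factorial := by
    rw [cast_prod]
    exact shiftedFactorial_mul_of_even he (hm.mul_left 3) (by push_cast; exact hme) _
  have h := congrArg (Nat.cast : ℕ → ZMod (p ^ 2)) (centralBinom_mul_prod_eq (3 * m) n m)
  rw [← hpm] at h
  simp only [Nat.cast_mul, Nat.cast_pow, Nat.cast_prod (s := Finset.range n),
    Nat.cast_prod (s := Finset.range (2 * n)), cast_block] at h
  rw [Finset.prod_const, Finset.prod_const, Finset.card_range, Finset.card_range, ← pow_mul,
    mul_comm n 2, cast_prod, cast_prod, Nat.cast_mul, Nat.cast_two] at h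
  have hW := isUnit_factorial (k := 3 * m) (by omega)
  have hP : IsUnit (shiftedFactorial m (-1 * (p : ZMod (p ^ 2)))) := by
    have h0 := shiftedFactorial_two_mul_mul he hm hme 0
    rw [zero_add] at h0
    exact isUnit_of_mul_isUnit_right (h0 ▸ hW)
  have hC : ((p * n + m).centralBinom : ZMod (p ^ 2)) *
      shiftedFactorial m ((n : ZMod (p ^ 2)) * p) ^ 2 =
      n.centralBinom * shiftedFactorial (2 * m) (2 * (n : ZMod (p ^ 2)) * p) := by
    apply (hW.pow (2 * n)).mul_left_cancel
    linear_combination h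
  have hsq := shiftedFactorial_sq_mul he m (n : ZMod (p ^ 2))
  have hrefl := shiftedFactorial_two_mul_mul he hm hme (2 * (n : ZMod (p ^ 2)))
  have hrefl0 := shiftedFactorial_two_mul_mul he hm hme 0
  rw [zero_mul, shiftedFactorial_zero_right, zero_add, factorial_two_mul, Nat.cast_mul,
    Nat.cast_pow] at hrefl0
  apply (hP.mul ((isUnit_factorial (k := m) (by omega)).pow 2)).mul_right_cancel
  rw [Nat.cast_mul]
  linear_combination shiftedFactorial m (-(2 * (n : ZMod (p ^ 2)) + 1) * p) * hC -
    ((p * n + m).centralBinom : ZMod (p ^ 2)) * hsq +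
    (n.centralBinom : ZMod (p ^ 2)) * (hrefl - hrefl0)

/-- If p ≡ 1 (mod 3) and ℓ ≥ 0, then
C(2(p^ℓ-1)/3, (p^ℓ-1)/3) ≡ C(2(p-1)/3, (p-1)/3)^ℓ (mod p²). -/
theorem choose_center_pow (p : ℕ) (hp : p.Prime) (hp3 : p % 3 = 1) (l : ℕ) :
    (2 * (p ^ l - 1) / 3).choose ((p ^ l - 1) / 3) ≡
      ((2 * (p - 1) / 3).choose ((p - 1) / 3)) ^ l [MOD p ^ 2] := by
  obtain ⟨m, hpm⟩ : ∃ m, p = 3 * m + 1 := ⟨p / 3, by omega⟩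
  have key (l : ℕ) : ∃ n, p ^ l = 3 * n + 1 ∧ n.centralBinom ≡ m.centralBinom ^ l [MOD p ^ 2] := by
    induction l with
    | zero => exact ⟨0, by simp, by simp [Nat.ModEq.refl]⟩
    | succ l ih =>
      obtain ⟨n, hn, h⟩ := ih
      refine ⟨p * n + m, ?_, (centralBinom_mul_add_modEq hp hpm n).trans ?_⟩
      · rw [pow_succ, hn, add_mul, mul_right_comm, one_mul]
        linarith
      · rw [pow_succ]
        exact h.mul_right _
  obtain ⟨n, hn, h⟩ := key l
  rw [hn, show 2 * (3 * n + 1 - 1) / 3 = 2 * n by omega, show (3 * n + 1 - 1) / 3 = n by omega,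
    show 2 * (p - 1) / 3 = 2 * m by omega, show (p - 1) / 3 = m by omega]
  exact h
end

section
/- Let p be a prime, let r, s be integers with 0 ≤ s ≤ r ≤ p-1, and let a ≥ 0 and b ≥ 0 be integers. Then C(p·a + r, p·b + s) ≡ C(a,b)·C(r,s)·(1 + p·a·(H_r - H_{r-s}) + p·b·(H_{r-s} - H_s)) (mod p²), where both sides are rational numbers whose denominators are not divisible by p. -/
/-- `X ≡ Y (mod p^k)` for rational numbers: `X - Y`, written in lowest terms,
has numerator divisible by `p^k`. -/
def RatModEq (p k : ℕ) (X Y : ℚ) : Prop := (p : ℤ) ^ k ∣ (X - Y).num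

/-- `Nat.choose_succ_right_eq` with the subtraction in `ℚ`. -/
lemma cast_choose_succ_mul (n k : ℕ) :
    (n.choose (k + 1) : ℚ) * (k + 1) = n.choose k * (n - k) := by
  rcases le_or_gt k n with h | h
  · have := Nat.choose_succ_right_eq n k
    rw [← Nat.cast_sub h]
    exact_mod_cast this
  · simp [Nat.choose_eq_zero_of_lt h, Nat.choose_eq_zero_of_lt (h.trans (Nat.lt_succ_self k))]

/-- `Nat.choose_mul_succ_eq` with the subtraction in `ℚ`. -/
lemma cast_succ_choose_mul (n k : ℕ) :
    ((n + 1).choose k : ℚ) * (n + 1 - k) = n.choose k * (n + 1) := by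
  rcases le_or_gt k (n + 1) with h | h
  · have := Nat.choose_mul_succ_eq n k
    rw [← Nat.cast_add_one, ← Nat.cast_sub h]
    exact_mod_cast this.symm
  · simp [Nat.choose_eq_zero_of_lt h, Nat.choose_eq_zero_of_lt ((Nat.lt_succ_self n).trans h)]

lemma Nat.Prime.dvd_choose_mul_of_not_dvd {p : ℕ} (hp : p.Prime) (a : ℕ) {m : ℕ} (hm : ¬p ∣ m) :
    p ∣ (p * a).choose m := by
  obtain ⟨k, rfl⟩ : ∃ k, m = k + 1 := Nat.exists_eq_succ_of_ne_zero (by rintro rfl; simp at hm)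
  have h : p ∣ (p * a).choose (k + 1) * (k + 1) := by
    by_cases ha : p * a = 0
    · simp [ha]
    · obtain ⟨n, hn⟩ := Nat.exists_eq_succ_of_ne_zero ha
      rw [hn, Nat.succ_eq_add_one, ← Nat.add_one_mul_choose_eq, ← Nat.succ_eq_add_one, ← hn]
      exact (dvd_mul_right p a).mul_right _
  exact (hp.dvd_mul.mp h).resolve_right hm

lemma Nat.Prime.choose_mul_mul_modEq_sq {p : ℕ} (hp : p.Prime) (a b : ℕ) :
    (p * a).choose (p * b) ≡ a.choose b [MOD p ^ 2] := by
  induction a generalizing b with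
  | zero =>
    rcases Nat.eq_zero_or_pos b with rfl | hb
    · simp [Nat.ModEq.refl]
    · simp [Nat.choose_eq_zero_of_lt hb, Nat.choose_eq_zero_of_lt (Nat.mul_pos hp.pos hb),
        Nat.ModEq.refl]
  | succ a ih =>
    cases b with
    | zero => simp [Nat.ModEq.refl]
    | succ b =>
      have hsplit : (p * (a + 1)).choose (p * (b + 1)) ≡
          (p * a).choose (p * (b + 1)) + (p * a).choose (p * b) [MOD p ^ 2] := by
        have hpa : p * (a + 1) = p + p * a := by ring
        have hp0 := hp.pos
        rw [hpa, Nat.add_choose_eq, Finset.Nat.sum_antidiagonal_eq_sum_range_succ_mk,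
          ← Finset.sum_subset (s₁ := Finset.range (p + 1))]
        · obtain ⟨q, hq⟩ : ∃ q, p = q + 1 := ⟨p - 1, by omega⟩
          rw [Finset.sum_range_succ, hq, Finset.sum_range_succ', ← hq]
          have hmid : p ^ 2 ∣ ∑ k ∈ Finset.range q,
              p.choose (k + 1) * (p * a).choose (p * (b + 1) - (k + 1)) := by
            refine Finset.dvd_sum fun k hk => ?_
            have hkq := Finset.mem_range.mp hk
            rw [pow_two]
            refine mul_dvd_mul (hp.dvd_choose_self (by omega) (by omega))
              (hp.dvd_choose_mul_of_not_dvd a fun hd => ?_)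
            have hle : k + 1 ≤ p * (b + 1) := by nlinarith
            have := (Nat.dvd_sub_iff_right hle (dvd_mul_right p _)).mp hd
            exact absurd (Nat.le_of_dvd (by omega) this) (by omega)
          have hb : p * (b + 1) - p = p * b := by rw [mul_add, mul_one, Nat.add_sub_cancel]
          have := (((Nat.modEq_zero_iff_dvd.mpr hmid).add_right
            ((p * a).choose (p * (b + 1)))).add_right ((p * a).choose (p * b)))
          simpa [hb] using this
        · intro k hk
          simp only [Finset.mem_range] at hk ⊢
          nlinarith
        · intro k _ hk
          simp only [Finset.mem_range, not_lt] at hk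
          simp [Nat.choose_eq_zero_of_lt (show p < k by omega)]
      rw [Nat.choose_succ_succ, add_comm (a.choose b)]
      exact hsplit.trans ((ih (b + 1)).add (ih b))

lemma Int.not_natCast_dvd_mul_add {p : ℕ} (d : ℤ) {t : ℕ} (h0 : 0 < t) (ht : t < p) : ¬(p : ℤ) ∣ p * d + t := by
  rw [dvd_add_right (dvd_mul_right _ _)]
  exact_mod_cast Nat.not_dvd_of_pos_of_lt h0 ht

section PadicInteger

variable {p : ℕ} [Fact p.Prime]

lemma Rat.inv_intCast_mem_padicInteger {n : ℤ} (hn : ¬(p : ℤ) ∣ n) :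
    ((n : ℚ)⁻¹) ∈ (Rat.padicValuation p).integer := by
  rw [Valuation.mem_integer_iff, map_inv₀, Rat.padicValuation_cast,
    Int.padicValuation_eq_one_iff.mpr hn, inv_one]

lemma Rat.inv_natCast_mem_padicInteger {n : ℕ} (h0 : 0 < n) (hn : n < p) :
    ((n : ℚ)⁻¹) ∈ (Rat.padicValuation p).integer := by
  exact_mod_cast Rat.inv_intCast_mem_padicInteger (p := p) (n := n)
    (by exact_mod_cast Nat.not_dvd_of_pos_of_lt h0 hn)

lemma harmonic_mem_padicInteger {n : ℕ} (hn : n < p) :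
    harmonic n ∈ (Rat.padicValuation p).integer :=
  sum_mem fun i hi => Rat.inv_natCast_mem_padicInteger i.succ_pos
    (by have := Finset.mem_range.mp hi; omega)

lemma RatModEq.of_sub_eq {k : ℕ} {X Y z : ℚ} (hz : z ∈ (Rat.padicValuation p).integer)
    (h : X - Y = (p : ℚ) ^ k * z) : RatModEq p k X Y := by
  rw [Valuation.mem_integer_iff, Rat.padicValuation_le_one_iff] at hz
  unfold RatModEq
  have hden : (z.den : ℚ) ≠ 0 := by exact_mod_cast z.den_ne_zero
  have hden' : ((X - Y).den : ℚ) ≠ 0 := by exact_mod_cast (X - Y).den_ne_zero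
  have hmul : (X - Y).num * z.den = (p : ℤ) ^ k * (z.num * (X - Y).den) := by
    have h1 := Rat.mul_den_eq_num (X - Y)
    have h2 := Rat.mul_den_eq_num z
    have : ((X - Y).num : ℚ) * z.den = (p : ℚ) ^ k * (z.num * (X - Y).den) := by
      rw [← h1, ← h2]
      linear_combination (z.den * (X - Y).den : ℚ) * h
    exact_mod_cast this
  have hcop : IsCoprime ((p : ℤ) ^ k) z.den :=
    (Nat.isCoprime_iff_coprime.mpr (((Fact.out : p.Prime).coprime_iff_not_dvd).mpr hz)).pow_left
  exact hcop.dvd_of_dvd_mul_right (Dvd.intro _ hmul.symm)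

/-- A congruence modulo `p ^ 2` propagates along a recursion `X' * u = X * v` with `u` a unit. -/
lemma exists_sub_eq_sq_mul_of_recursion {X Y X' Y' u v w : ℚ}
    (hu : u ≠ 0) (hui : u⁻¹ ∈ (Rat.padicValuation p).integer)
    (hv : v ∈ (Rat.padicValuation p).integer) (hw : w ∈ (Rat.padicValuation p).integer)
    (hX : X' * u = X * v) (hY : v * Y - u * Y' = (p : ℚ) ^ 2 * w)
    (h : ∃ z ∈ (Rat.padicValuation p).integer, X - Y = (p : ℚ) ^ 2 * z) :
    ∃ z ∈ (Rat.padicValuation p).integer, X' - Y' = (p : ℚ) ^ 2 * z := by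
  obtain ⟨z, hz, h⟩ := h
  refine ⟨u⁻¹ * (v * z + w), mul_mem hui (add_mem (mul_mem hv hz) hw), ?_⟩
  field_simp
  linear_combination hX + v * h + hY

lemma exists_choose_mul_add_mul_sub_eq {r : ℕ} (hr : r < p) (a b : ℕ) :
    ∃ z ∈ (Rat.padicValuation p).integer,
      ((p * a + r).choose (p * b) : ℚ) - a.choose b * (1 + p * b * harmonic r) =
        (p : ℚ) ^ 2 * z := by
  induction r with
  | zero =>
    obtain ⟨z, hz⟩ := ((Fact.out : p.Prime).choose_mul_mul_modEq_sq a b).symm.dvd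
    refine ⟨z, intCast_mem _ z, ?_⟩
    simp only [add_zero, harmonic_zero, mul_zero, mul_one]
    exact_mod_cast hz
  | succ r ih =>
    have hnd := Int.not_natCast_dvd_mul_add (p := p) (a - b : ℤ) r.succ_pos hr
    have hu : ((p * (a - b) + r.succ : ℤ) : ℚ) ≠ 0 := by
      intro h0
      rw [Int.cast_eq_zero.mp h0] at hnd
      exact hnd (dvd_zero _)
    have hr0 : (r + 1 : ℚ) ≠ 0 := by positivity
    have hinv := Rat.inv_natCast_mem_padicInteger (p := p) r.succ_pos hr
    have hH := harmonic_mem_padicInteger (p := p) (n := r) (by omega)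
    refine exists_sub_eq_sq_mul_of_recursion (v := ((p * a + r + 1 : ℕ) : ℚ))
      (w := a.choose b * (b * b * harmonic r - (a - b) * b * ((r.succ : ℕ) : ℚ)⁻¹))
      hu (Rat.inv_intCast_mem_padicInteger hnd) (natCast_mem _ _) ?_ ?_ ?_ (ih (by omega))
    · refine mul_mem (natCast_mem _ _) (sub_mem (mul_mem (mul_mem ?_ ?_) hH)
        (mul_mem (mul_mem (sub_mem ?_ ?_) ?_) hinv)) <;> exact natCast_mem _ _
    · have := cast_succ_choose_mul (p * a + r) (p * b)
      push_cast at this ⊢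
      rw [← add_assoc]
      linear_combination this
    · rw [harmonic_succ]
      push_cast
      field_simp
      ring

lemma exists_choose_mul_add_mul_add_sub_eq {r s : ℕ} (hsr : s ≤ r) (hr : r < p) (a b : ℕ) :
    ∃ z ∈ (Rat.padicValuation p).integer,
      ((p * a + r).choose (p * b + s) : ℚ) - (a.choose b : ℚ) * (r.choose s : ℚ) *
        (1 + (p : ℚ) * a * (harmonic r - harmonic (r - s)) +
          (p : ℚ) * b * (harmonic (r - s) - harmonic s)) = (p : ℚ) ^ 2 * z := by
  induction s with
  | zero => simpa using exists_choose_mul_add_mul_sub_eq hr a b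
  | succ s ih =>
    obtain ⟨m, rfl⟩ : ∃ m, r = s + 1 + m := ⟨r - (s + 1), by omega⟩
    have hnd := Int.not_natCast_dvd_mul_add (p := p) (b : ℤ) s.succ_pos (by omega : s + 1 < p)
    have hu : ((p * b + s.succ : ℤ) : ℚ) ≠ 0 := by positivity
    have ht := Rat.inv_natCast_mem_padicInteger (p := p) s.succ_pos (by omega : s + 1 < p)
    have hm := Rat.inv_natCast_mem_padicInteger (p := p) m.succ_pos (by omega : m + 1 < p)
    have hHr := harmonic_mem_padicInteger hr
    have hHm := harmonic_mem_padicInteger (p := p) (n := m + 1) (by omega)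
    have hHs := harmonic_mem_padicInteger (p := p) (n := s) (by omega)
    have hsub : s + 1 + m - s = m + 1 := by omega
    have hsub' : s + 1 + m - (s + 1) = m := by omega
    have hchoose : ((s + 1 + m).choose (s + 1) : ℚ) =
        (s + 1 + m).choose s * (m + 1) * ((s.succ : ℕ) : ℚ)⁻¹ := by
      have := cast_choose_succ_mul (s + 1 + m) s
      push_cast at this ⊢
      field_simp
      linear_combination this
    have ih := ih (by omega)
    rw [hsub] at ih
    rw [hsub', hchoose]
    refine exists_sub_eq_sq_mul_of_recursion (v := ((p * (a - b) + (m + 1) : ℤ) : ℚ))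
      (w := a.choose b * (s + 1 + m).choose s *
        ((a - b) * (a * (harmonic (s + 1 + m) - harmonic (m + 1)) +
            b * (harmonic (m + 1) - harmonic s)) -
          (m + 1 : ℕ) * ((s.succ : ℕ) : ℚ)⁻¹ * b *
            (a * (harmonic (s + 1 + m) - harmonic (m + 1)) +
              b * (harmonic (m + 1) - harmonic s) +
              (a - b) * ((m.succ : ℕ) : ℚ)⁻¹ - b * ((s.succ : ℕ) : ℚ)⁻¹)))
      hu (Rat.inv_intCast_mem_padicInteger hnd) (intCast_mem _ _) ?_ ?_ ?_ ih
    · have hN (n : ℕ) : (n : ℚ) ∈ (Rat.padicValuation p).integer := natCast_mem _ n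
      have hd := sub_mem (hN a) (hN b)
      have hα := add_mem (mul_mem (hN a) (sub_mem hHr hHm)) (mul_mem (hN b) (sub_mem hHm hHs))
      exact mul_mem (mul_mem (hN _) (hN _)) (sub_mem (mul_mem hd hα)
        (mul_mem (mul_mem (mul_mem (hN _) ht) (hN _))
          (sub_mem (add_mem hα (mul_mem hd hm)) (mul_mem (hN _) ht))))
    · have := cast_choose_succ_mul (p * a + (s + 1 + m)) (p * b + s)
      push_cast at this ⊢
      rw [← add_assoc (p * b) s 1]
      linear_combination this
    · rw [harmonic_succ m, harmonic_succ s]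
      push_cast
      field_simp
      ring

end PadicInteger

/-- For 0 ≤ s ≤ r ≤ p-1 and a, b ≥ 0,
C(pa+r, pb+s) ≡ C(a,b)·C(r,s)·(1 + pa(H_r - H_{r-s}) + pb(H_{r-s} - H_s)) (mod p²). -/
theorem general_congruence (p : ℕ) (hp : p.Prime) (r s : ℕ) (hsr : s ≤ r)
    (hr : r ≤ p - 1) (a b : ℕ) :
    RatModEq p 2 (((p * a + r).choose (p * b + s) : ℚ))
      ((a.choose b : ℚ) * (r.choose s : ℚ) *
        (1 + (p : ℚ) * a * (harmonic r - harmonic (r - s)) +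
          (p : ℚ) * b * (harmonic (r - s) - harmonic s))) := by
  have : Fact p.Prime := ⟨hp⟩
  have hrp : r < p := by have := hp.pos; omega
  obtain ⟨z, hz, h⟩ := exists_choose_mul_add_mul_add_sub_eq hsr hrp a b
  exact RatModEq.of_sub_eq hz h
end

section
/- Let p be a prime, let r be an integer with 0 ≤ r ≤ p-1, and let a ≥ 0 be an integer. Then the integer congruence ∏_{i=1}^{r} (p·a + i) ≡ r! + p·a·∑_{i=1}^{r} (r!/i) (mod p²) holds, where each r!/i is an integer. -/
theorem sum_factorial_succ_div (r : ℕ) :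
    ∑ i ∈ Finset.Icc 1 (r + 1), (r + 1).factorial / i =
      (r + 1) * (∑ i ∈ Finset.Icc 1 r, r.factorial / i) + r.factorial := by
  rw [Finset.sum_Icc_succ_top (by omega), Finset.mul_sum, Nat.factorial_succ,
    Nat.mul_div_cancel_left _ r.succ_pos]
  congr 1
  refine Finset.sum_congr rfl fun i hi => ?_
  obtain ⟨h1, h2⟩ := Finset.mem_Icc.mp hi
  exact Nat.mul_div_assoc _ (Nat.dvd_factorial h1 h2)

theorem exists_prod_add_eq_factorial_add (x r : ℕ) :
    ∃ k, ∏ i ∈ Finset.Icc 1 r, (x + i) =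
      r.factorial + x * (∑ i ∈ Finset.Icc 1 r, r.factorial / i) + x ^ 2 * k := by
  induction r with
  | zero => exact ⟨0, by simp⟩
  | succ r ih =>
    obtain ⟨k, hk⟩ := ih
    refine ⟨∑ i ∈ Finset.Icc 1 r, r.factorial / i + k * (x + (r + 1)), ?_⟩
    rw [Finset.prod_Icc_succ_top (by omega), hk, sum_factorial_succ_div, Nat.factorial_succ]
    ring

/-- For 0 ≤ r ≤ p-1 and a ≥ 0,
∏_{i=1}^{r} (pa + i) ≡ r! + pa·∑_{i=1}^{r} (r!/i) (mod p²). -/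
theorem prod_shift_mod_p_sq (p : ℕ) (hp : p.Prime) (r : ℕ) (hr : r ≤ p - 1) (a : ℕ) :
    (∏ i ∈ Finset.Icc 1 r, (p * a + i)) ≡
      r.factorial + p * a * (∑ i ∈ Finset.Icc 1 r, r.factorial / i) [MOD p ^ 2] := by
  obtain ⟨k, hk⟩ := exists_prod_add_eq_factorial_add (p * a) r
  rw [hk, mul_pow, mul_assoc (p ^ 2)]
  simp [Nat.ModEq]
end

section
/- Let p be a prime and let r, s ∈ {0, 1, ..., p-1}. If the congruence C(p·a + r, p·b + s) ≡ C(a,b)·C(r,s) (mod p²) holds for all integers a ≥ 0 and b ≥ 0, then s ≤ r and the congruence C(p·a + r, p·b + (r-s)) ≡ C(a,b)·C(r, r-s) (mod p²) also holds for all integers a ≥ 0 and b ≥ 0. -/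
/-- If the Lucas congruence modulo p² holds for the pair (r, s), then
s ≤ r and it also holds for the reflected pair (r, r - s). -/
theorem lucas_mod_p_sq_reflect (p : ℕ) (hp : p.Prime) (r s : ℕ) (hr : r < p) (hs : s < p)
    (h : ∀ a b : ℕ, (p * a + r).choose (p * b + s) ≡ a.choose b * r.choose s [MOD p ^ 2]) :
    s ≤ r ∧
      ∀ a b : ℕ, (p * a + r).choose (p * b + (r - s)) ≡
        a.choose b * r.choose (r - s) [MOD p ^ 2] := by
  have hsr : s ≤ r := by
    by_contra! hlt
    have h10 := h 1 0
    rw [Nat.choose_eq_zero_of_lt hlt, mul_zero, mul_one, mul_zero, zero_add,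
      Nat.modEq_zero_iff_dvd] at h10
    have hle : ((p + r).choose s).factorization p ≤ 1 :=
      Nat.factorization_choose_le_one (by nlinarith [hp.two_le])
    have hne : (p + r).choose s ≠ 0 := (Nat.choose_pos (by lia)).ne'
    have hge := (hp.pow_dvd_iff_le_factorization hne).1 h10
    lia
  refine ⟨hsr, fun a b ↦ ?_⟩
  rcases le_or_gt b a with hba | hab
  · obtain ⟨c, rfl⟩ := Nat.exists_eq_add_of_le hba
    have hsplit : p * (b + c) + r = (p * c + s) + (p * b + (r - s)) := by
      rw [mul_add]
      lia
    rw [← Nat.choose_symm_of_eq_add hsplit, Nat.choose_symm hsr, Nat.choose_symm_add]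
    exact h (b + c) c
  · have hlt : p * a + r < p * b + (r - s) := by
      have := Nat.mul_le_mul_left p (Nat.succ_le_of_lt hab)
      rw [Nat.mul_succ] at this
      lia
    rw [Nat.choose_eq_zero_of_lt hlt, Nat.choose_eq_zero_of_lt hab, zero_mul]
end

section
/- Let p be a prime and let r, s be integers with 0 ≤ s ≤ r ≤ p-1. Then C(r,s) ≡ (-1)^{r-s}·C(p-1-s, r-s)·(1 + p·H_r - p·H_s) (mod p²), where both sides are rational numbers whose denominators are not divisible by p. -/
/-- The ring of `p`-integral rational numbers. -/
noncomputable def pIntegralRat (p : ℕ) [Fact p.Prime] : Subring ℚ :=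
  (PadicInt.subring p).comap (Rat.castHom ℚ_[p])

lemma mem_pIntegralRat {p : ℕ} [Fact p.Prime] {x : ℚ} :
    x ∈ pIntegralRat p ↔ ‖(x : ℚ_[p])‖ ≤ 1 := Iff.rfl

lemma inv_natCast_mem_pIntegralRat {p : ℕ} [Fact p.Prime] {k : ℕ} (hk : 0 < k) (hkp : k < p) :
    (k : ℚ)⁻¹ ∈ pIntegralRat p := by
  have h : ‖(k : ℚ_[p])‖ = 1 :=
    Padic.norm_natCast_eq_one_iff.2 (Nat.coprime_of_lt_prime hk.ne' hkp Fact.out)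
  rw [mem_pIntegralRat]
  simp [h]

lemma harmonic_mem_pIntegralRat {p : ℕ} [Fact p.Prime] {k : ℕ} (hk : k < p) :
    harmonic k ∈ pIntegralRat p := by
  refine Subring.sum_mem _ fun i hi => inv_natCast_mem_pIntegralRat i.succ_pos ?_
  have := Finset.mem_range.1 hi
  omega

lemma ratModEq_of_sub_eq {p k : ℕ} [Fact p.Prime] {X Y t : ℚ} (ht : t ∈ pIntegralRat p)
    (h : X - Y = (p : ℚ) ^ k * t) : RatModEq p k X Y := by
  have hn : (((X - Y).num : ℚ)) = (p : ℚ) ^ k * (t * (X - Y).den) := by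
    rw [← mul_assoc, ← h, Rat.mul_den_eq_num]
  have hu : t * (X - Y).den ∈ pIntegralRat p := mul_mem ht (natCast_mem _ _)
  have hc : (((X - Y).num : ℤ) : ℚ_[p]) = (p : ℚ_[p]) ^ k * ((t * (X - Y).den : ℚ) : ℚ_[p]) := by
    exact_mod_cast congrArg (fun x : ℚ => (x : ℚ_[p])) hn
  have hd : ((p ^ k : ℕ) : ℤ) ∣ (X - Y).num := by
    have := (Padic.norm_int_le_pow_iff_dvd (p := p) (X - Y).num k).1 (by
      rw [hc, norm_mul, Padic.norm_p_pow]
      exact mul_le_of_le_one_right (by positivity) (mem_pIntegralRat.1 hu))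
    exact_mod_cast this
  exact_mod_cast hd

/-- The `p`-integral quotient by `p ^ 2` of the difference of the two sides of
`general_rotation`, with `r = s + n`. -/
lemma exists_choose_sub_eq_sq_mul {p : ℕ} [Fact p.Prime] (s n : ℕ) (h : s + n < p) :
    ∃ t ∈ pIntegralRat p, ((s + n).choose s : ℚ) - (-1) ^ n * ((p - 1 - s).choose n : ℚ) *
      (1 + (p : ℚ) * harmonic (s + n) - (p : ℚ) * harmonic s) = (p : ℚ) ^ 2 * t := by
  induction n with
  | zero => exact ⟨0, zero_mem _, by simp⟩
  | succ n ih =>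
    obtain ⟨t, ht, e⟩ := ih (by omega)
    have hA : ((s + (n + 1)).choose s : ℚ) * (n + 1) = (s + n).choose s * (s + n + 1) := by
      have := Nat.choose_mul_succ_eq (s + n) s
      rw [show s + n + 1 - s = n + 1 by omega] at this
      exact_mod_cast this.symm
    have hD : ((p - 1 - s).choose (n + 1) : ℚ) * (n + 1) =
        (p - 1 - s).choose n * (p - (s + n + 1)) := by
      have := Nat.choose_succ_right_eq (p - 1 - s) n
      rw [show p - 1 - s - n = p - (s + n + 1) by omega] at this
      have h' := congrArg (fun x : ℕ => (x : ℚ)) this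
      push_cast [Nat.cast_sub (show s + n + 1 ≤ p by omega)] at h'
      exact h'
    have hH : harmonic (s + (n + 1)) = harmonic (s + n) + ((s + n + 1 : ℕ) : ℚ)⁻¹ :=
      harmonic_succ _
    have hi : ((s + n + 1 : ℕ) : ℚ) * ((s + n + 1 : ℕ) : ℚ)⁻¹ = 1 :=
      mul_inv_cancel₀ (by positivity)
    refine ⟨((s + n + 1 : ℕ) * t + (-1) ^ n * ((p - 1 - s).choose n : ℚ) *
      (harmonic (s + (n + 1)) - harmonic s)) * ((n + 1 : ℕ) : ℚ)⁻¹, ?_, ?_⟩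
    · refine mul_mem (add_mem (mul_mem (natCast_mem _ _) ht) (mul_mem (mul_mem
        (pow_mem (neg_mem (one_mem _)) _) (natCast_mem _ _)) (sub_mem ?_ ?_))) ?_
      · exact harmonic_mem_pIntegralRat h
      · exact harmonic_mem_pIntegralRat (by omega)
      · exact inv_natCast_mem_pIntegralRat n.succ_pos (by omega)
    · rw [← mul_assoc, ← div_eq_mul_inv, eq_div_iff (by positivity), hH]
      push_cast at hi ⊢
      set i := ((s : ℚ) + n + 1)⁻¹
      set D := ((p - 1 - s).choose n : ℚ)
      set E := 1 + (p : ℚ) * (harmonic (s + n) + i) - p * harmonic s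
      rw [pow_succ]
      linear_combination hA + (-1) ^ n * E * hD + (s + n + 1 : ℚ) * e
        - (-1) ^ n * D * p * hi

/-- For 0 ≤ s ≤ r ≤ p-1,
C(r,s) ≡ (-1)^(r-s)·C(p-1-s, r-s)·(1 + p·H_r - p·H_s) (mod p²). -/
theorem general_rotation (p : ℕ) (hp : p.Prime) (r s : ℕ) (hsr : s ≤ r)
    (hr : r ≤ p - 1) :
    RatModEq p 2 ((r.choose s : ℚ))
      ((-1 : ℚ) ^ (r - s) * ((p - 1 - s).choose (r - s) : ℚ) *
        (1 + (p : ℚ) * harmonic r - (p : ℚ) * harmonic s)) := by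
  have : Fact p.Prime := ⟨hp⟩
  obtain ⟨n, rfl⟩ := Nat.exists_eq_add_of_le hsr
  obtain ⟨t, ht, e⟩ := exists_choose_sub_eq_sq_mul (p := p) s n (by have := hp.pos; omega)
  rw [Nat.add_sub_cancel_left]
  exact ratModEq_of_sub_eq ht e
end

section
/- Let p be a prime and let r be an integer with 0 ≤ r ≤ p-1. Then r!·(p-1-r)! ≡ (-1)^{p-1-r}·(p-1)!·(1 - p·(H_{p-1} - H_r)) (mod p²), where both sides are rational numbers whose denominators are not divisible by p. -/
lemma exists_int_factorial_mul_harmonic_sub (r m : ℕ) :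
    ∃ B : ℤ, ((r + m).factorial : ℚ) * (harmonic (r + m) - harmonic r) = B := by
  induction m with
  | zero => exact ⟨0, by simp⟩
  | succ m ih =>
    obtain ⟨B, hB⟩ := ih
    refine ⟨(r + m + 1) * B + (r + m).factorial, ?_⟩
    have h : ((r : ℚ) + m + 1) ≠ 0 := by positivity
    rw [← add_assoc, harmonic_succ, Nat.factorial_succ]
    push_cast
    rw [← hB]
    field_simp
    ring

/-- Expansion of `r! ∏ (x - j)`, for `j` from `r + 1` to `r + m`, up to an integral multiple
of `x ^ 2`. -/
lemma exists_int_factorial_mul_prod_sub (x : ℤ) (r m : ℕ) :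
    ∃ A : ℤ, (r.factorial : ℚ) * ∏ i ∈ Finset.range m, ((x : ℚ) - (r + i + 1)) =
      (-1) ^ m * ((r + m).factorial : ℚ) * (1 - x * (harmonic (r + m) - harmonic r)) +
        x ^ 2 * A := by
  induction m with
  | zero => exact ⟨0, by simp⟩
  | succ m ih =>
    obtain ⟨A, hA⟩ := ih
    obtain ⟨B, hB⟩ := exists_int_factorial_mul_harmonic_sub r m
    refine ⟨A * (x - (r + m + 1)) - (-1) ^ m * B, ?_⟩
    have h : ((r : ℚ) + m + 1) ≠ 0 := by positivity
    rw [Finset.prod_range_succ, ← mul_assoc, hA, ← add_assoc, harmonic_succ, Nat.factorial_succ]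
    push_cast
    rw [← hB]
    field_simp
    ring

lemma prod_range_natCast_sub_eq_factorial (m : ℕ) :
    ∏ i ∈ Finset.range m, ((m : ℚ) - i) = m.factorial := by
  induction m with
  | zero => simp
  | succ m ih =>
    rw [Finset.prod_range_succ', Nat.factorial_succ]
    simp [ih, mul_comm]

/-- For 0 ≤ r ≤ p-1,
r!·(p-1-r)! ≡ (-1)^(p-1-r)·(p-1)!·(1 - p·(H_{p-1} - H_r)) (mod p²). -/
theorem factorial_product_mod_p_sq (p : ℕ) (hp : p.Prime) (r : ℕ) (hr : r ≤ p - 1) :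
    RatModEq p 2 ((r.factorial : ℚ) * ((p - 1 - r).factorial : ℚ))
      ((-1 : ℚ) ^ (p - 1 - r) * ((p - 1).factorial : ℚ) *
        (1 - (p : ℚ) * (harmonic (p - 1) - harmonic r))) := by
  obtain ⟨m, hm⟩ := Nat.exists_eq_add_of_le hr
  have hpm : p = r + m + 1 := by have := hp.pos; omega
  obtain ⟨A, hA⟩ := exists_int_factorial_mul_prod_sub p r m
  have hprod : ∏ i ∈ Finset.range m, (((p : ℤ) : ℚ) - (r + i + 1)) = m.factorial := by
    rw [← prod_range_natCast_sub_eq_factorial]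
    refine Finset.prod_congr rfl fun i _ => ?_
    rw [hpm]
    push_cast
    ring
  rw [hprod] at hA
  unfold RatModEq
  rw [hm, Nat.add_sub_cancel_left, hA, Int.cast_natCast, add_sub_cancel_left]
  have hcast : (p : ℚ) ^ 2 * A = ((p ^ 2 * A : ℤ) : ℚ) := by push_cast; rfl
  rw [hcast, Rat.num_intCast]
  exact dvd_mul_right _ _
end

section
/- Let p be a prime and let r, s be integers with 0 ≤ s ≤ r ≤ p-1. Then H_r ≡ H_{r-s} ≡ H_s (mod p) if and only if C(r,s) ≡ (-1)^{r-s}·C(p-1-s, r-s) ≡ (-1)^s·C(p-1-r+s, s) (mod p²). -/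
theorem RatModEq.symm {p k : ℕ} {X Y : ℚ} (h : RatModEq p k X Y) : RatModEq p k Y X := by
  unfold RatModEq at *
  rw [← neg_sub, Rat.num_neg_eq_neg_num]
  exact h.neg_right

theorem Rat.isCoprime_den_of_dvd_num {q : ℚ} {m : ℤ} (h : m ∣ q.num) : IsCoprime m q.den :=
  q.isCoprime_num_den.of_isCoprime_of_dvd_left h

theorem RatModEq.trans {p k : ℕ} {X Y Z : ℚ} (hXY : RatModEq p k X Y)
    (hYZ : RatModEq p k Y Z) : RatModEq p k X Z := by
  unfold RatModEq at *
  have hnum := Rat.add_num_den' (X - Y) (Y - Z)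
  rw [sub_add_sub_cancel] at hnum
  have hdvd : (p : ℤ) ^ k ∣ (X - Z).num * (X - Y).den * (Y - Z).den :=
    hnum ▸ ((hXY.mul_right _).add (hYZ.mul_right _)).mul_right _
  exact (Rat.isCoprime_den_of_dvd_num hXY).dvd_of_dvd_mul_right
    ((Rat.isCoprime_den_of_dvd_num hYZ).dvd_of_dvd_mul_right hdvd)

/-- Clearing a denominator coprime to `m` does not affect divisibility by `m`. -/
theorem Rat.dvd_num_iff_of_mul_eq {m a D : ℤ} {q : ℚ} (ha : IsCoprime m a)
    (h : (D : ℚ) = a * q) : m ∣ q.num ↔ m ∣ D := by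
  have hD : D * q.den = a * q.num := by
    have : (D : ℚ) * q.den = a * q.num := by rw [h, mul_assoc, Rat.mul_den_eq_num]
    exact_mod_cast this
  refine ⟨fun hq => ?_, fun hq => ha.dvd_of_dvd_mul_left (hD ▸ hq.mul_right _)⟩
  exact (Rat.isCoprime_den_of_dvd_num hq).dvd_of_dvd_mul_right (hD ▸ hq.mul_left _)

/-- First-order expansion of `∏ (j - p)` over `s < j ≤ s + k`, modulo `p ^ 2`. -/
theorem exists_prod_sub_modEq_sq (p : ℤ) (s k : ℕ) :
    ∃ D : ℤ, (D : ℚ) = ((s + 1).ascFactorial k : ℤ) * (harmonic (s + k) - harmonic s) ∧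
      ∏ i ∈ Finset.range k, ((s + 1 + i : ℤ) - p) ≡ (s + 1).ascFactorial k - p * D
        [ZMOD p ^ 2] := by
  induction k with
  | zero => exact ⟨0, by simp, by simp [Int.ModEq.refl]⟩
  | succ k ih =>
    obtain ⟨D, hD, hmod⟩ := ih
    refine ⟨D * (s + 1 + k) + (s + 1).ascFactorial k, ?_, ?_⟩
    · have hne : (s + 1 + k : ℚ) ≠ 0 := by positivity
      push_cast at hD ⊢
      rw [hD, ← add_assoc, harmonic_succ, Nat.ascFactorial_succ]
      push_cast
      rw [add_right_comm (s : ℚ) k 1]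
      field_simp
      ring
    · rw [Finset.prod_range_succ, Nat.ascFactorial_succ]
      refine (hmod.mul_right _).trans (Int.modEq_iff_dvd.2 ⟨-D, ?_⟩)
      push_cast
      ring

theorem neg_one_pow_mul_choose_mul_factorial {n s k : ℕ} (h : s + k < n) :
    (-1 : ℤ) ^ k * ((n - 1 - s).choose k : ℤ) * (k.factorial : ℤ) =
      ∏ i ∈ Finset.range k, ((s + 1 + i : ℤ) - n) := by
  rw [mul_assoc, mul_comm (Nat.cast _), ← Nat.cast_mul, ← Nat.descFactorial_eq_factorial_mul_choose,
    Nat.descFactorial_eq_prod_range, Nat.cast_prod]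
  conv_lhs => rw [← Finset.card_range k, ← Finset.prod_const, Finset.card_range]
  rw [← Finset.prod_mul_distrib]
  refine Finset.prod_congr rfl fun i hi => ?_
  have := Finset.mem_range.1 hi
  omega

theorem choose_modEq_sq_iff_harmonic {p : ℕ} (hp : p.Prime) {s k : ℕ} (h : s + k < p) :
    ((s + k).choose k : ℤ) ≡ (-1) ^ k * ((p - 1 - s).choose k : ℤ) [ZMOD (p : ℤ) ^ 2] ↔
      RatModEq p 1 (harmonic (s + k)) (harmonic s) := by
  obtain ⟨D, hD, hmod⟩ := exists_prod_sub_modEq_sq p s k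
  have hasc := Nat.ascFactorial_eq_factorial_mul_choose s k
  have hfact : IsCoprime (p : ℤ) (k.factorial : ℤ) :=
    Nat.isCoprime_iff_coprime.2 ((hp.coprime_iff_not_dvd).2 fun hd => by
      have := hp.dvd_factorial.1 hd
      omega)
  have hcop : IsCoprime (p : ℤ) ((s + 1).ascFactorial k : ℤ) :=
    Nat.isCoprime_iff_coprime.2 ((hp.coprime_iff_not_dvd).2 fun hd => by
      have := hp.dvd_factorial.1
        ((Nat.factorial_mul_ascFactorial s k) ▸ hd.mul_left s.factorial)
      omega)
  have hp0 : (p : ℤ) ≠ 0 := by exact_mod_cast hp.ne_zero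
  rw [RatModEq, pow_one, Rat.dvd_num_iff_of_mul_eq hcop hD,
    ← mul_dvd_mul_iff_left hp0, ← pow_two, Int.modEq_iff_dvd]
  rw [← neg_one_pow_mul_choose_mul_factorial h, Int.modEq_iff_dvd, hasc] at hmod
  push_cast at hmod
  have hcancel (x : ℤ) : (p : ℤ) ^ 2 ∣ x ↔ (p : ℤ) ^ 2 ∣ x * k.factorial :=
    ⟨fun hx => hx.mul_right _, hfact.pow_left.dvd_of_dvd_mul_right⟩
  rw [hcancel, ← dvd_add_right hmod, ← dvd_neg]
  ring_nf

/-- For 0 ≤ s ≤ r ≤ p-1, H_r ≡ H_{r-s} ≡ H_s (mod p) if and only if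
C(r,s) ≡ (-1)^(r-s)·C(p-1-s, r-s) ≡ (-1)^s·C(p-1-r+s, s) (mod p²). -/
theorem harmonic_iff_rotation_mod_p_sq (p : ℕ) (hp : p.Prime) (r s : ℕ) (hsr : s ≤ r)
    (hr : r ≤ p - 1) :
    (RatModEq p 1 (harmonic r) (harmonic (r - s)) ∧
        RatModEq p 1 (harmonic (r - s)) (harmonic s)) ↔
      (((r.choose s : ℤ) ≡ (-1) ^ (r - s) * ((p - 1 - s).choose (r - s) : ℤ)
          [ZMOD (p : ℤ) ^ 2]) ∧
        ((-1 : ℤ) ^ (r - s) * ((p - 1 - s).choose (r - s) : ℤ) ≡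
          (-1) ^ s * ((p - 1 - r + s).choose s : ℤ) [ZMOD (p : ℤ) ^ 2])) := by
  have hlt : r < p := by have := hp.pos; omega
  obtain ⟨k, rfl⟩ := Nat.exists_eq_add_of_le hsr
  have hs := choose_modEq_sq_iff_harmonic hp hlt
  have hk := choose_modEq_sq_iff_harmonic hp (s := k) (k := s) (by omega)
  rw [add_comm k s] at hk
  rw [← Nat.choose_symm_add] at hs
  have hidx : p - 1 - (s + k) + s = p - 1 - k := by omega
  rw [Nat.add_sub_cancel_left, hidx]
  constructor
  · rintro ⟨h₁, h₂⟩
    have hB := hs.2 (h₁.trans h₂)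
    exact ⟨hB, hB.symm.trans (hk.2 h₁)⟩
  · rintro ⟨h₁, h₂⟩
    have hH := hk.1 (h₁.trans h₂)
    exact ⟨hH, hH.symm.trans (hs.1 h₁)⟩
end

section
/- Let p be a prime and let r, s be integers with 0 ≤ s ≤ r ≤ p-1. Then H_r ≡ H_s (mod p) if and only if C(r,s) ≡ (-1)^{r-s}·C(p-1-s, r-s) (mod p²). -/
/-- Expansion to first order in `p` of the product of the `j - p` over `s < j ≤ s + d`: its linear
coefficient is the product of the `j` times `harmonic (s + d) - harmonic s`, an integer `E`. -/
theorem exists_harmonic_sub_eq_and_sq_dvd_descFactorial (p s d : ℕ) (h : s + d ≤ p - 1) :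
    ∃ E : ℤ, (E : ℚ) = ((s + 1).ascFactorial d : ℚ) * (harmonic (s + d) - harmonic s) ∧
      (p : ℤ) ^ 2 ∣ (-1) ^ d * ((p - 1 - s).descFactorial d : ℤ)
        - ((s + 1).ascFactorial d : ℤ) + p * E := by
  induction d with
  | zero => exact ⟨0, by simp⟩
  | succ d ih =>
    obtain ⟨E, hE, k, hk⟩ := ih (by omega)
    refine ⟨(s + 1 + d) * E + ((s + 1).ascFactorial d : ℤ), ?_, ?_⟩
    · rw [← add_assoc, harmonic_succ, Nat.ascFactorial_succ]
      have hne : ((s : ℚ) + d + 1) ≠ 0 := by positivity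
      push_cast
      rw [hE]
      field_simp
      ring
    · have hc : ((p - 1 - s - d : ℕ) : ℤ) = p - 1 - s - d := by omega
      rw [Nat.descFactorial_succ, Nat.ascFactorial_succ]
      push_cast
      rw [hc]
      exact ⟨E + (s + 1 + d - p) * k, by linear_combination ((s : ℤ) + 1 + d - p) * hk⟩

/-- If `E = m * q` with `E`, `m` integers and `m` prime to `p`, then `p` divides `E` exactly when
it divides the numerator of `q`. -/
theorem Rat.prime_dvd_num_iff_of_eq_mul {p : ℕ} (hp : p.Prime) {m E : ℤ} {q : ℚ}
    (hm : ¬ (p : ℤ) ∣ m) (hE : (E : ℚ) = m * q) : (p : ℤ) ∣ q.num ↔ (p : ℤ) ∣ E := by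
  have hpz : Prime (p : ℤ) := Nat.prime_iff_prime_int.mp hp
  have key : E * q.den = m * q.num := by
    have : (E : ℚ) * q.den = m * q.num := by rw [hE, mul_assoc, Rat.mul_den_eq_num]
    exact_mod_cast this
  constructor
  · intro h
    refine (hpz.dvd_or_dvd (key ▸ h.mul_left m)).resolve_right fun hd => ?_
    exact hp.one_lt.ne' <| Nat.eq_one_of_dvd_coprimes q.reduced
      (Int.natCast_dvd.mp h) (Int.natCast_dvd_natCast.mp hd)
  · intro h
    exact (hpz.dvd_or_dvd (key ▸ h.mul_right (q.den : ℤ))).resolve_left hm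

/-- For 0 ≤ s ≤ r ≤ p-1, H_r ≡ H_s (mod p) if and only if
C(r,s) ≡ (-1)^(r-s)·C(p-1-s, r-s) (mod p²). -/
theorem harmonic_eq_iff_rotation (p : ℕ) (hp : p.Prime) (r s : ℕ) (hsr : s ≤ r)
    (hr : r ≤ p - 1) :
    RatModEq p 1 (harmonic r) (harmonic s) ↔
      ((r.choose s : ℤ) ≡ (-1) ^ (r - s) * ((p - 1 - s).choose (r - s) : ℤ)
        [ZMOD (p : ℤ) ^ 2]) := by
  obtain ⟨d, rfl⟩ := Nat.exists_eq_add_of_le hsr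
  have hp1 := hp.one_lt
  obtain ⟨E, hE, hdvd⟩ := exists_harmonic_sub_eq_and_sq_dvd_descFactorial p s d hr
  have hP : ¬ (p : ℤ) ∣ ((s + 1).ascFactorial d : ℤ) := by
    rw [Int.natCast_dvd_natCast]
    intro h
    have h' := h.mul_left s.factorial
    rw [Nat.factorial_mul_ascFactorial, hp.dvd_factorial] at h'
    omega
  have hd : IsCoprime ((p : ℤ) ^ 2) (d.factorial : ℤ) := by
    refine IsCoprime.pow_left (Nat.isCoprime_iff_coprime.mpr ?_)
    rw [hp.coprime_iff_not_dvd, hp.dvd_factorial]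
    omega
  rw [RatModEq, pow_one, Rat.prime_dvd_num_iff_of_eq_mul hp hP (by exact_mod_cast hE),
    Nat.add_sub_cancel_left, Int.modEq_iff_dvd]
  rw [Nat.ascFactorial_eq_factorial_mul_choose, Nat.descFactorial_eq_factorial_mul_choose,
    ← Nat.choose_symm_add] at hdvd
  push_cast at hdvd
  have hpne : (p : ℤ) ≠ 0 := by exact_mod_cast hp.ne_zero
  rw [← mul_dvd_mul_iff_left hpne, ← sq]
  rw [show (-1) ^ d * ((d.factorial : ℤ) * ((p - 1 - s).choose d : ℤ))
      - (d.factorial : ℤ) * ((s + d).choose s : ℤ)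
      = d.factorial * ((-1) ^ d * ((p - 1 - s).choose d : ℤ) - ((s + d).choose s : ℤ)) by ring]
    at hdvd
  exact ⟨fun h => hd.dvd_of_dvd_mul_left ((dvd_add_left h).mp hdvd),
    fun h => (dvd_add_right (h.mul_left _)).mp hdvd⟩
end

section
/- Let p be an odd prime. Then 2^{p-1} ≡ 1 (mod p²) if and only if the congruence C(p·a + (p-1)/2, p·b + (p-1)/2) ≡ C(a,b)·C((p-1)/2, (p-1)/2) (mod p²) holds for all integers a ≥ 0 and b ≥ 0. -/
open Polynomial in
theorem Polynomial.coeff_one_add_X_pow_pow_mul {p n : ℕ} (hn : n < p) {h : ℤ[X]}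
    (hh : ∀ i, p + n ≤ i → h.coeff i = 0) (a b : ℕ) :
    ((1 + X ^ p) ^ a * h).coeff (p * b + n) = a.choose b * h.coeff n := by
  have hexp : (1 + X ^ p : ℤ[X]) ^ a * h
      = ∑ m ∈ Finset.range (a + 1), C (a.choose m : ℤ) * (X ^ (p * m) * h) := by
    rw [add_comm, add_pow, Finset.sum_mul]
    refine Finset.sum_congr rfl fun m _ => ?_
    simp only [one_pow, mul_one, ← pow_mul, map_natCast]
    ring
  rw [hexp, finsetSum_coeff, Finset.sum_eq_single b]
  · rw [coeff_C_mul, add_comm, coeff_X_pow_mul]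
  · intro m _ hmb
    rw [coeff_C_mul, coeff_X_pow_mul']
    split_ifs with hle
    · rcases lt_or_gt_of_ne hmb with hlt | hgt
      · rw [hh, mul_zero]
        have : p * (m + 1) ≤ p * b := Nat.mul_le_mul_left _ hlt
        rw [mul_add] at this
        omega
      · have : p * (b + 1) ≤ p * m := Nat.mul_le_mul_left _ hgt
        rw [mul_add] at this
        omega
    · rw [mul_zero]
  · intro hb
    rw [Finset.mem_range, not_lt] at hb
    rw [Nat.choose_eq_zero_of_lt hb]
    simp

open Polynomial in
/-- The failure of Lucas's congruence modulo `p ^ 2` at equal lower digits `n` is controlled by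
the single binomial coefficient `(p + n).choose n`. -/
theorem Nat.Prime.exists_choose_eq_choose_add {p n : ℕ} (hp : p.Prime) (hn : n < p) (a b : ℕ) :
    ∃ k : ℤ, ((p * a + n).choose (p * b + n) : ℤ) =
      a.choose b + a * (a - 1).choose b * ((p + n).choose n - 1) + p ^ 2 * k := by
  obtain ⟨r, hr⟩ := exists_add_pow_prime_eq hp (1 : ℤ[X]) X
  rw [one_pow, mul_one] at hr
  set h : ℤ[X] := X * r * (1 + X) ^ n with hh
  have hph : C (p : ℤ) * h = (1 + X) ^ (p + n) - (1 + X) ^ n - X ^ p * (1 + X) ^ n := by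
    rw [hh, pow_add, hr, map_natCast]
    ring
  have hcoeff (i : ℕ) : (p : ℤ) * h.coeff i = (p + n).choose i - n.choose i -
      if p ≤ i then (n.choose (i - p) : ℤ) else 0 := by
    rw [← coeff_C_mul, hph, coeff_sub, coeff_sub, coeff_X_pow_mul']
    simp only [coeff_one_add_X_pow]
  have hzero (i : ℕ) (hi : p + n ≤ i) : h.coeff i = 0 := by
    have hp0 : (p : ℤ) ≠ 0 := mod_cast hp.ne_zero
    suffices (p : ℤ) * h.coeff i = 0 from (_root_.mul_eq_zero.1 this).resolve_left hp0
    rw [hcoeff, if_pos (by omega), Nat.choose_eq_zero_of_lt (show n < i by omega)]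
    rcases hi.eq_or_lt with rfl | hlt
    · simp
    · rw [Nat.choose_eq_zero_of_lt hlt, Nat.choose_eq_zero_of_lt (show n < i - p by omega)]
      simp
  have hmid : (p : ℤ) * h.coeff n = (p + n).choose n - 1 := by
    rw [hcoeff, if_neg (by omega), Nat.choose_self]
    simp
  obtain ⟨K, hK⟩ := powAddExpansion (1 + X ^ p : ℤ[X]) ((p : ℤ[X]) * (X * r)) a
  have hmain : (1 + X : ℤ[X]) ^ (p * a + n) = (1 + X ^ p) ^ a * (1 + X) ^ n +
      C ((a : ℤ) * p) * ((1 + X ^ p) ^ (a - 1) * h) +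
      C ((p : ℤ) ^ 2) * (K * (X * r) ^ 2 * (1 + X) ^ n) := by
    rw [pow_add, pow_mul, hr, mul_assoc (p : ℤ[X]), hK, hh]
    simp only [map_mul, map_pow, map_natCast]
    ring
  refine ⟨(K * (X * r) ^ 2 * (1 + X) ^ n).coeff (p * b + n), ?_⟩
  have := congrArg (fun q => q.coeff (p * b + n)) hmain
  simp only [coeff_add, coeff_C_mul] at this
  rw [coeff_one_add_X_pow_pow_mul hn hzero, coeff_one_add_X_pow_pow_mul hn, coeff_one_add_X_pow,
    coeff_one_add_X_pow, Nat.choose_self] at this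
  · rw [this, ← hmid]
    push_cast
    ring
  · intro i hi
    rw [coeff_one_add_X_pow, Nat.choose_eq_zero_of_lt (by have := hp.pos; omega), Nat.cast_zero]

/-- The homogeneous first-order expansion of `∏ (y * k + x)`; its linear coefficient does not
depend on `x` and `y`. -/
theorem exists_forall_mul_prod_add_modEq (n : ℕ) :
    ∃ e : ℤ, ∀ x y : ℤ, y * ∏ k ∈ Finset.range n, (y * (k + 1) + x) ≡
      y ^ n * (y * n.factorial + x * e) [ZMOD x ^ 2] := by
  induction n with
  | zero => exact ⟨0, fun x y => by simp [Int.ModEq.refl]⟩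
  | succ n ih =>
    obtain ⟨e, he⟩ := ih
    refine ⟨(n + 1) * e + n.factorial, fun x y => ?_⟩
    rw [Finset.prod_range_succ, ← mul_assoc]
    refine ((he x y).mul_right _).trans (Int.modEq_iff_dvd.2 ⟨-(y ^ n * e), ?_⟩)
    rw [Nat.factorial_succ]
    push_cast
    ring

theorem Nat.two_pow_mul_prod_odd (n : ℕ) :
    2 ^ n * ∏ j ∈ Finset.range n, (2 * j + 1) = n.factorial * n.centralBinom := by
  induction n with
  | zero => simp
  | succ n ih =>
    rw [Finset.prod_range_succ, Nat.factorial_succ, pow_succ]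
    have := Nat.succ_mul_centralBinom_succ n
    calc _ = (2 ^ n * ∏ j ∈ Finset.range n, (2 * j + 1)) * (2 * (2 * n + 1)) := by ring
      _ = n.factorial * (2 * (2 * n + 1) * n.centralBinom) := by rw [ih]; ring
      _ = _ := by rw [← this]; ring

theorem Nat.factorial_mul_choose_eq_prod (m n : ℕ) :
    n.factorial * (m + n).choose n = ∏ k ∈ Finset.range n, (k + 1 + m) := by
  rw [← Nat.ascFactorial_eq_factorial_mul_choose, Nat.ascFactorial_eq_prod_range]
  exact Finset.prod_congr rfl fun k _ => by ring

theorem two_pow_mul_prod_two_mul_sub (n : ℕ) :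
    (2 : ℤ) ^ n * ∏ k ∈ Finset.range n, (2 * ((k : ℤ) + 1) + -(2 * n + 1)) =
      ∏ k ∈ Finset.range n, (1 * ((k : ℤ) + 1) + -(2 * n + 1)) := by
  have h : (2 : ℤ) ^ n * ∏ j ∈ Finset.range n, (2 * (j : ℤ) + 1) =
      ∏ j ∈ Finset.range n, ((j : ℤ) + 1 + n) := by
    have := Nat.two_pow_mul_prod_odd n
    rw [Nat.centralBinom, two_mul, Nat.factorial_mul_choose_eq_prod] at this
    exact_mod_cast this
  rw [← Finset.prod_range_reflect, ← Finset.prod_range_reflect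
    (fun k : ℕ => (1 * ((k : ℤ) + 1) + -(2 * n + 1)))]
  have hcast (j : ℕ) (hj : j ∈ Finset.range n) : ((n - 1 - j : ℕ) : ℤ) = n - 1 - j := by
    have := Finset.mem_range.1 hj
    omega
  have hl : ∏ j ∈ Finset.range n, (2 * (((n - 1 - j : ℕ) : ℤ) + 1) + -(2 * n + 1)) =
      ∏ j ∈ Finset.range n, (-1 : ℤ) * (2 * (j : ℤ) + 1) :=
    Finset.prod_congr rfl fun j hj => by rw [hcast j hj]; ring
  have hr : ∏ j ∈ Finset.range n, (1 * (((n - 1 - j : ℕ) : ℤ) + 1) + -(2 * n + 1)) =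
      ∏ j ∈ Finset.range n, (-1 : ℤ) * ((j : ℤ) + 1 + n) :=
    Finset.prod_congr rfl fun j hj => by rw [hcast j hj]; ring
  rw [hl, hr, Finset.prod_mul_distrib, Finset.prod_mul_distrib, ← h]
  ring

theorem Nat.Prime.two_pow_modEq_one_iff_choose_modEq_one {p n : ℕ} (hp : p.Prime)
    (hpn : p = 2 * n + 1) :
    (p : ℤ) ^ 2 ∣ 2 ^ (2 * n) - 1 ↔ (p : ℤ) ^ 2 ∣ (p + n).choose n - 1 := by
  obtain ⟨e, he⟩ := exists_forall_mul_prod_add_modEq n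
  have hF : IsCoprime ((p : ℤ) ^ 2) n.factorial := by
    refine IsCoprime.pow_left (Nat.isCoprime_iff_coprime.2 ?_)
    exact (Nat.coprime_factorial_iff hp.ne_one).2 (by rw [hp.minFac_eq]; omega)
  have h2 : IsCoprime ((p : ℤ) ^ 2) 2 := by
    refine IsCoprime.pow_left ⟨1, -n, ?_⟩
    rw [hpn]; push_cast; ring
  have hC : (p : ℤ) ^ 2 ∣ n.factorial * ((p + n).choose n - 1) - p * e := by
    have h1 := (he p 1).symm.dvd
    have hprod : (n.factorial : ℤ) * (p + n).choose n
        = ∏ k ∈ Finset.range n, ((k : ℤ) + 1 + p) := mod_cast Nat.factorial_mul_choose_eq_prod p n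
    simp only [one_mul, one_pow] at h1
    rw [← hprod] at h1
    convert h1 using 1
    ring
  have hW : (p : ℤ) ^ 2 ∣ 2 ^ (2 * n) * (2 * n.factorial - p * e)
      - 2 * (n.factorial - p * e) := by
    have h1 := he (-p) 1
    have h2 := (he (-p) 2).mul_left (2 ^ n)
    have hid := two_pow_mul_prod_two_mul_sub n
    have hpz : (p : ℤ) = 2 * n + 1 := mod_cast hpn
    rw [← hpz] at hid
    rw [mul_left_comm, hid] at h2
    simp only [one_pow, one_mul] at h1 h2
    have h3 := ((h1.mul_left 2).symm.trans h2).dvd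
    rw [neg_sq] at h3
    convert h3 using 1
    ring
  have hCe : (p : ℤ) ^ 2 ∣ (p + n).choose n - 1 ↔ (p : ℤ) ^ 2 ∣ p * e := by
    rw [← dvd_iff_dvd_of_dvd_sub hC]
    exact ⟨fun h => h.mul_left _, hF.dvd_of_dvd_mul_left⟩
  rw [hCe]
  constructor
  · intro h
    rw [show (p : ℤ) * e = 2 ^ (2 * n) * (2 * n.factorial - p * e) - 2 * (n.factorial - p * e)
      - (2 ^ (2 * n) - 1) * (2 * n.factorial - p * e) by ring]
    exact _root_.dvd_sub hW (h.mul_right _)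
  · intro h
    refine hF.dvd_of_dvd_mul_left (h2.dvd_of_dvd_mul_left ?_)
    have := _root_.dvd_add hW (h.mul_left (2 ^ (2 * n) - 2))
    convert this using 1
    ring

/-- For an odd prime p, 2^(p-1) ≡ 1 (mod p²) if and only if the Lucas
congruence modulo p² holds for the pair ((p-1)/2, (p-1)/2) for all a, b ≥ 0. -/
theorem wieferich_iff_lucas_midpoint (p : ℕ) (hp : p.Prime) (hodd : Odd p) :
    2 ^ (p - 1) ≡ 1 [MOD p ^ 2] ↔
      ∀ a b : ℕ, (p * a + (p - 1) / 2).choose (p * b + (p - 1) / 2) ≡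
        a.choose b * ((p - 1) / 2).choose ((p - 1) / 2) [MOD p ^ 2] := by
  obtain ⟨n, hpn⟩ := hodd
  have hhalf : (p - 1) / 2 = n := by omega
  have hsub : p - 1 = 2 * n := by omega
  have key := hp.two_pow_modEq_one_iff_choose_modEq_one hpn
  rw [hhalf, hsub]
  simp only [Nat.choose_self, mul_one]
  rw [Nat.ModEq.comm, Nat.modEq_iff_dvd]
  push_cast
  rw [key]
  constructor
  · intro h a b
    obtain ⟨k, hk⟩ := hp.exists_choose_eq_choose_add (show n < p by omega) a b
    rw [Nat.ModEq.comm, Nat.modEq_iff_dvd, hk]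
    push_cast
    rw [add_assoc, add_sub_cancel_left]
    exact (h.mul_left _).add (dvd_mul_right _ k)
  · intro h
    simpa using (h 1 0).symm.dvd
end

section
/- Let p be an odd prime. Then 2^{p-1} ≡ 1 (mod p²) if and only if H_{(p-1)/2} ≡ 0 (mod p). -/
theorem two_ne_zero_zmod_of_odd_prime {p : ℕ} (hp : p.Prime) (hodd : Odd p) :
    (2 : ZMod p) ≠ 0 := by
  have h : ((2 : ℕ) : ZMod p) ≠ 0 := by
    rw [Ne, ZMod.natCast_eq_zero_iff, Nat.prime_dvd_prime_iff_eq hp Nat.prime_two]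
    rintro rfl
    exact absurd hodd (by decide)
  exact_mod_cast h

/-- Below `p`, the harmonic numbers are `p`-integral and reduce termwise modulo `p`. -/
theorem harmonic_cast_zmod (p : ℕ) [Fact p.Prime] {n : ℕ} (hn : n < p) :
    ((harmonic n).den : ZMod p) ≠ 0 ∧
      ((harmonic n : ℚ) : ZMod p) = ∑ i ∈ Finset.range n, ((i : ZMod p) + 1)⁻¹ := by
  induction n with
  | zero => simp
  | succ n ih =>
    obtain ⟨hden, hcast⟩ := ih (by omega)
    have hn0 : ((n + 1 : ℕ) : ZMod p) ≠ 0 := by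
      rw [Ne, ZMod.natCast_eq_zero_iff]
      exact Nat.not_dvd_of_pos_of_lt n.succ_pos hn
    have hinv : (((((n + 1 : ℕ) : ℚ)⁻¹).den : ℕ) : ZMod p) ≠ 0 := by
      rwa [Rat.inv_natCast_den_of_pos n.succ_pos]
    rw [harmonic_succ]
    constructor
    · intro h
      rw [ZMod.natCast_eq_zero_iff] at h
      have h' : (((harmonic n).den * (((n + 1 : ℕ) : ℚ)⁻¹).den : ℕ) : ZMod p) = 0 :=
        (ZMod.natCast_eq_zero_iff _ _).2 (h.trans (Rat.add_den_dvd _ _))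
      rw [Nat.cast_mul] at h'
      exact mul_ne_zero hden hinv h'
    · rw [Rat.cast_add_of_ne_zero hden hinv, hcast, Finset.sum_range_succ,
        Rat.cast_inv_nat]
      simp

/-- The alternating harmonic sum of even length is a difference of harmonic sums. -/
theorem sum_alternating_inv {K : Type*} [Field K] (h2 : (2 : K) ≠ 0) (m : ℕ) :
    ∑ i ∈ Finset.range (2 * m), (-1 : K) ^ i * ((i : K) + 1)⁻¹ =
      ∑ i ∈ Finset.range (2 * m), ((i : K) + 1)⁻¹ - ∑ i ∈ Finset.range m, ((i : K) + 1)⁻¹ := by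
  induction m with
  | zero => simp
  | succ m ih =>
    have key : ((m : K) + 1)⁻¹ = 2 * (2 * (m : K) + 1 + 1)⁻¹ := by
      rw [show 2 * (m : K) + 1 + 1 = 2 * (m + 1) by ring, mul_inv, mul_inv_cancel_left₀ h2]
    rw [show 2 * (m + 1) = 2 * m + 1 + 1 by ring]
    simp only [Finset.sum_range_succ, ih, pow_succ, pow_mul, key]
    push_cast
    norm_num
    ring

theorem sum_range_inv_zmod_eq_zero (p : ℕ) [Fact p.Prime] (hodd : Odd p) :
    ∑ i ∈ Finset.range (p - 1), ((i : ZMod p) + 1)⁻¹ = 0 := by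
  have h2 : (2 : ZMod p) ≠ 0 := two_ne_zero_zmod_of_odd_prime Fact.out hodd
  have hneg : ∑ i ∈ Finset.range (p - 1), ((i : ZMod p) + 1)⁻¹ =
      -∑ i ∈ Finset.range (p - 1), ((i : ZMod p) + 1)⁻¹ := by
    conv_lhs => rw [← Finset.sum_range_reflect]
    rw [← Finset.sum_neg_distrib]
    refine Finset.sum_congr rfl fun i hi => ?_
    have hi' := Finset.mem_range.1 hi
    have h : ((p - 1 - 1 - i : ℕ) : ZMod p) + 1 + (i + 1) = 0 := by
      have : ((p - 1 - 1 - i + 1 + (i + 1) : ℕ) : ZMod p) = (p : ℕ) := by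
        congr 1
        omega
      rw [ZMod.natCast_self] at this
      exact_mod_cast this
    rw [eq_neg_of_add_eq_zero_left h, inv_neg]
  refine (mul_eq_zero.1 ?_).resolve_left h2
  rw [two_mul]
  exact eq_neg_iff_add_eq_zero.1 hneg

theorem choose_prime_sub_one_zmod (p : ℕ) [Fact p.Prime] {k : ℕ} (hk : k < p) :
    ((p - 1).choose k : ZMod p) = (-1) ^ k := by
  induction k with
  | zero => simp
  | succ k ih =>
    have hp : p - 1 + 1 = p := Nat.sub_add_cancel (Fact.out : p.Prime).one_le
    have hdvd : p ∣ p.choose (k + 1) :=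
      (Fact.out : p.Prime).dvd_choose_self k.succ_ne_zero hk
    rw [← ZMod.natCast_eq_zero_iff] at hdvd
    have hpas := Nat.choose_succ_succ (p - 1) k
    rw [Nat.succ_eq_add_one, Nat.succ_eq_add_one, hp] at hpas
    rw [hpas, Nat.cast_add, ih (by omega)] at hdvd
    rw [eq_neg_of_add_eq_zero_right hdvd, pow_succ, mul_neg_one]

/-- The numbers `(p choose i + 1) / p` reduce to `(-1) ^ i / (i + 1)` modulo `p`. -/
theorem choose_div_prime_zmod (p : ℕ) [Fact p.Prime] {i : ℕ} (hi : i < p - 1) :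
    ((p.choose (i + 1) / p : ℕ) : ZMod p) = (-1) ^ i * ((i : ZMod p) + 1)⁻¹ := by
  have hprime : p.Prime := Fact.out
  have hi0 : ((i : ZMod p) + 1) ≠ 0 := by
    have : ((i + 1 : ℕ) : ZMod p) ≠ 0 := by
      rw [Ne, ZMod.natCast_eq_zero_iff]
      exact Nat.not_dvd_of_pos_of_lt i.succ_pos (by omega)
    exact_mod_cast this
  obtain ⟨a, ha⟩ := hprime.dvd_choose_self i.succ_ne_zero (by omega : i + 1 < p)
  have habs := Nat.add_one_mul_choose_eq (p - 1) i
  rw [Nat.sub_add_cancel hprime.one_le, ha, mul_assoc] at habs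
  have hmul := Nat.eq_of_mul_eq_mul_left hprime.pos habs
  rw [ha, Nat.mul_div_cancel_left _ hprime.pos, eq_mul_inv_iff_mul_eq₀ hi0,
    ← choose_prime_sub_one_zmod p (by omega : i < p), hmul]
  push_cast
  rfl

theorem two_pow_prime_eq (p : ℕ) (hp : p.Prime) :
    2 ^ p = 2 + p * ∑ i ∈ Finset.range (p - 1), p.choose (i + 1) / p := by
  have hp1 : p - 1 + 1 = p := Nat.sub_add_cancel hp.one_le
  rw [← Nat.sum_range_choose, Finset.sum_range_succ, ← hp1, Finset.sum_range_succ', hp1,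
    Finset.mul_sum]
  have : ∀ i ∈ Finset.range (p - 1), p * (p.choose (i + 1) / p) = p.choose (i + 1) := by
    intro i hi
    have := Finset.mem_range.1 hi
    exact Nat.mul_div_cancel' (hp.dvd_choose_self i.succ_ne_zero (by omega))
  rw [Finset.sum_congr rfl this, Nat.choose_zero_right, Nat.choose_self]
  ring

/-- For an odd prime p, 2^(p-1) ≡ 1 (mod p²) if and only if
H_{(p-1)/2} ≡ 0 (mod p). -/
theorem wieferich_iff_harmonic (p : ℕ) (hp : p.Prime) (hodd : Odd p) :
    2 ^ (p - 1) ≡ 1 [MOD p ^ 2] ↔ RatModEq p 1 (harmonic ((p - 1) / 2)) 0 := by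
  have : Fact p.Prime := ⟨hp⟩
  have h2 : (2 : ZMod p) ≠ 0 := two_ne_zero_zmod_of_odd_prime hp hodd
  have hp0 := hp.pos
  have hm : 2 * ((p - 1) / 2) = p - 1 := by
    obtain ⟨k, rfl⟩ := hodd
    omega
  have hsum : ((∑ i ∈ Finset.range (p - 1), p.choose (i + 1) / p : ℕ) : ZMod p) =
      -((harmonic ((p - 1) / 2) : ℚ) : ZMod p) := by
    rw [Nat.cast_sum, Finset.sum_congr rfl
      fun i hi => choose_div_prime_zmod p (Finset.mem_range.1 hi)]
    have h := sum_alternating_inv h2 ((p - 1) / 2)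
    rw [hm, sum_range_inv_zmod_eq_zero p hodd, zero_sub] at h
    rw [h, (harmonic_cast_zmod p (by omega : (p - 1) / 2 < p)).2]
  have hleft : 2 ^ (p - 1) ≡ 1 [MOD p ^ 2] ↔
      ((∑ i ∈ Finset.range (p - 1), p.choose (i + 1) / p : ℕ) : ZMod p) = 0 := by
    have hcop : Nat.gcd (p ^ 2) 2 = 1 :=
      Nat.Coprime.pow_left 2 (Nat.coprime_two_right.2 hodd)
    have hmul : 2 ^ (p - 1) ≡ 1 [MOD p ^ 2] ↔ 2 * 2 ^ (p - 1) ≡ 2 * 1 [MOD p ^ 2] :=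
      ⟨fun h => h.mul_left 2, fun h => Nat.ModEq.cancel_left_of_coprime hcop h⟩
    rw [hmul, ← pow_succ', Nat.sub_add_cancel hp.one_le, two_pow_prime_eq p hp, mul_one,
      Nat.ModEq.comm, Nat.modEq_iff_dvd' (Nat.le_add_right _ _), Nat.add_sub_cancel_left,
      pow_two, Nat.mul_dvd_mul_iff_left hp.pos, ZMod.natCast_eq_zero_iff]
  rw [hleft, hsum, neg_eq_zero, RatModEq, sub_zero, pow_one, Rat.cast_def,
    div_eq_zero_iff, or_iff_left (harmonic_cast_zmod p (by omega : (p - 1) / 2 < p)).1,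
    ZMod.intCast_zmod_eq_zero_iff_dvd]
end

section
/- Let p ≥ 5 be a prime and let a ≥ 0 and b ≥ 0 be integers. Then C(p·a, p·b) ≡ C(a,b) (mod p³). -/
open Polynomial in
theorem ZMod.ascPochhammer_self (p : ℕ) [Fact p.Prime] :
    ascPochhammer (ZMod p) p = X ^ p - X := by
  have hp : p.Prime := Fact.out
  have hdeg : (X ^ p - X : (ZMod p)[X]).degree = p := by
    rw [degree_eq_natDegree (FiniteField.X_pow_card_sub_X_ne_zero _ hp.one_lt),
      FiniteField.X_pow_card_sub_X_natDegree_eq _ hp.one_lt]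
  have hmonic : (X ^ p - X : (ZMod p)[X]).Monic :=
    monic_X_pow_sub (by rw [degree_X]; exact_mod_cast hp.one_lt)
  have hdeg' : (ascPochhammer (ZMod p) p).degree = p := by
    rw [degree_eq_natDegree (monic_ascPochhammer _ _).ne_zero, ascPochhammer_natDegree]
  refine eq_of_degree_sub_lt_of_eval_finset_eq Finset.univ ?_ fun x _ => ?_
  · rw [Finset.card_univ, ZMod.card, ← hdeg']
    exact degree_sub_lt_left (hdeg'.trans hdeg.symm) (monic_ascPochhammer _ _).ne_zero
      ((monic_ascPochhammer _ _).leadingCoeff.trans hmonic.leadingCoeff.symm)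
  · have h := ascPochhammer_eval_neg_coe_nat_of_lt (R := ZMod p) (ZMod.val_lt (-x))
    rw [ZMod.natCast_zmod_val, neg_neg] at h
    simp [h]

open Polynomial in
/-- An integer polynomial agreeing at `0` and `-p`, with `X²`-coefficient divisible by `p`,
is constant modulo `p³` on the multiples of `p`. -/
theorem Polynomial.pow_three_dvd_eval_mul_sub_eval_zero {f : ℤ[X]} {p : ℤ} (hp : p ≠ 0)
    (h₂ : p ∣ f.coeff 2) (hsymm : f.eval (-p) = f.eval 0) (k : ℤ) :
    p ^ 3 ∣ f.eval (p * k) - f.eval 0 := by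
  obtain ⟨g, hg⟩ : ∃ g : ℤ[X], ∀ x : ℤ,
      f.eval x = f.eval 0 + f.coeff 1 * x + f.coeff 2 * x ^ 2 + g.eval x * x ^ 3 := by
    refine ⟨f.divX.divX.divX, fun x => ?_⟩
    conv_lhs => rw [← divX_mul_X_add f, ← divX_mul_X_add f.divX, ← divX_mul_X_add f.divX.divX]
    simp only [coeff_divX, eval_add, eval_mul, eval_X, eval_C, ← coeff_zero_eq_eval_zero]
    ring
  obtain ⟨d, hd⟩ := h₂
  have h₁ : f.coeff 1 = p ^ 2 * (d - g.eval (-p)) := by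
    refine mul_left_cancel₀ hp ?_
    have := hg (-p)
    rw [hsymm, hd] at this
    linear_combination this
  rw [hg (p * k), h₁, hd]
  exact ⟨(d - g.eval (-p)) * k + d * k ^ 2 + g.eval (p * k) * k ^ 3, by ring⟩

open Polynomial in
theorem Nat.Prime.ascFactorial_mul_add_one_modEq {p : ℕ} (hp : p.Prime) (hp5 : 5 ≤ p) (k : ℕ) :
    (p * k + 1).ascFactorial (p - 1) ≡ (p - 1).factorial [MOD p ^ 3] := by
  have := Fact.mk hp
  set f : ℤ[X] := (ascPochhammer ℤ (p - 1)).comp (X + 1) with hf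
  have hX : ascPochhammer ℤ p = X * f := by
    rw [hf, ← ascPochhammer_succ_left, Nat.sub_add_cancel hp.one_le]
  have h₂ : (p : ℤ) ∣ f.coeff 2 := by
    rw [← ZMod.intCast_zmod_eq_zero_iff_dvd, ← coeff_X_mul, ← hX, ← eq_intCast (Int.castRingHom _),
      ← coeff_map, ascPochhammer_map, ZMod.ascPochhammer_self, coeff_sub, coeff_X_pow, coeff_X,
      if_neg (by omega), if_neg (by omega), sub_zero]
  have heval (n : ℕ) : f.eval (n : ℤ) = ((n + 1).ascFactorial (p - 1) : ℕ) := by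
    rw [hf, Nat.cast_ascFactorial]
    simp
  have heval0 : f.eval 0 = ((p - 1).factorial : ℕ) := by
    simpa [Nat.one_ascFactorial] using heval 0
  have hsymm : f.eval (-(p : ℤ)) = f.eval 0 := by
    have h : (-(p : ℤ) + 1) = -((p - 1 : ℕ) : ℤ) := by
      rw [Nat.cast_sub hp.one_le]
      ring
    rw [heval0, hf, eval_comp, eval_add, eval_X, eval_one, h,
      ascPochhammer_eval_neg_eq_descPochhammer, descPochhammer_eval_eq_descFactorial,
      Nat.descFactorial_self, (hp.even_sub_one (by omega)).neg_one_pow, one_mul]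
  have h := pow_three_dvd_eval_mul_sub_eval_zero (by exact_mod_cast hp.ne_zero) h₂ hsymm k
  rw [← Nat.cast_mul, heval, heval0] at h
  refine ((Nat.modEq_iff_dvd).2 ?_).symm
  exact_mod_cast h

theorem Nat.Prime.exists_factorial_mul_eq {p : ℕ} (hp : p.Prime) (hp5 : 5 ≤ p) (a : ℕ) :
    ∃ u, (p * a).factorial = p ^ a * a.factorial * u ∧
      u ≡ (p - 1).factorial ^ a [MOD p ^ 3] := by
  induction a with
  | zero => exact ⟨1, by simp, by simp [Nat.ModEq.refl]⟩
  | succ a ih =>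
    obtain ⟨u, hu, hmod⟩ := ih
    refine ⟨u * (p * a + 1).ascFactorial (p - 1), ?_, ?_⟩
    · have h : (p * a + 1).ascFactorial p
          = (p * a + p) * (p * a + 1).ascFactorial (p - 1) := by
        obtain ⟨q, rfl⟩ := Nat.exists_eq_add_of_le' hp.one_le
        rw [Nat.add_sub_cancel, Nat.ascFactorial_succ]
        ring
      rw [mul_add_one, ← Nat.factorial_mul_ascFactorial, h, hu, Nat.factorial_succ]
      ring
    · rw [pow_succ]
      exact hmod.mul (hp.ascFactorial_mul_add_one_modEq hp5 a)

/-- Jacobsthal–Ljunggren: For a prime p ≥ 5 and a, b ≥ 0,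
C(pa, pb) ≡ C(a,b) (mod p³). -/
theorem jacobsthal_ljunggren (p : ℕ) (hp : p.Prime) (hp5 : 5 ≤ p) (a b : ℕ) :
    (p * a).choose (p * b) ≡ a.choose b [MOD p ^ 3] := by
  obtain hab | hab := lt_or_ge a b
  · rw [Nat.choose_eq_zero_of_lt hab, Nat.choose_eq_zero_of_lt (by gcongr)]
  obtain ⟨c, rfl⟩ := Nat.exists_eq_add_of_le' hab
  obtain ⟨u, hu, hu'⟩ := hp.exists_factorial_mul_eq hp5 (c + b)
  obtain ⟨v, hv, hv'⟩ := hp.exists_factorial_mul_eq hp5 b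
  obtain ⟨w, hw, hw'⟩ := hp.exists_factorial_mul_eq hp5 c
  have key : (p * (c + b)).choose (p * b) * (w * v) = (c + b).choose b * u := by
    have h := Nat.add_choose_mul_factorial_mul_factorial (p * c) (p * b)
    rw [← mul_add, hu, hw, hv, ← Nat.add_choose_mul_factorial_mul_factorial c b] at h
    have hpos : 0 < p ^ (c + b) * (c.factorial * b.factorial) :=
      Nat.mul_pos (pow_pos hp.pos _) (Nat.mul_pos c.factorial_pos b.factorial_pos)
    refine Nat.eq_of_mul_eq_mul_left hpos ?_
    rw [pow_add] at h ⊢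
    linear_combination h
  have hcop : (p ^ 3).gcd ((p - 1).factorial ^ (c + b)) = 1 :=
    Nat.Coprime.pow _ _ (hp.coprime_factorial_of_lt (Nat.sub_lt hp.pos one_pos))
  refine Nat.ModEq.cancel_right_of_coprime hcop ?_
  calc (p * (c + b)).choose (p * b) * (p - 1).factorial ^ (c + b)
      ≡ (p * (c + b)).choose (p * b) * (w * v) [MOD p ^ 3] := by
        rw [pow_add]
        exact ((hw'.mul hv').symm).mul_left _
    _ = (c + b).choose b * u := key
    _ ≡ (c + b).choose b * (p - 1).factorial ^ (c + b) [MOD p ^ 3] := hu'.mul_left _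
end

section
/- Let p be any prime and let a ≥ 0 and b ≥ 0 be integers. Then C(p·a, p·b) ≡ C(a,b) (mod p²). -/
theorem Nat.Prime.dvd_mul_choose_of_not_dvd {p : ℕ} (hp : p.Prime) (a : ℕ) {k : ℕ}
    (hk : ¬ p ∣ k) : p ∣ (p * a).choose k := by
  obtain ⟨k, rfl⟩ : ∃ j, k = j + 1 :=
    Nat.exists_eq_succ_of_ne_zero fun h => hk (h ▸ dvd_zero p)
  rcases h : p * a with _ | n
  · simp
  · have key := Nat.add_one_mul_choose_eq n k
    refine (hp.dvd_mul.1 ?_).resolve_right hk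
    rw [← key, ← h, mul_assoc]
    exact dvd_mul_right _ _

theorem Nat.Prime.choose_mul_succ_modEq {p : ℕ} (hp : p.Prime) (a b : ℕ) :
    (p * (a + 1)).choose (p * (b + 1)) ≡
      (p * a).choose (p * b) + (p * a).choose (p * (b + 1)) [MOD p ^ 2] := by
  rw [← ZMod.natCast_eq_natCast_iff, mul_add_one p a, add_comm (p * a) p, Nat.add_choose_eq,
    Finset.Nat.sum_antidiagonal_eq_sum_range_succ (fun i j => p.choose i * (p * a).choose j),
    Nat.cast_sum, ← Finset.sum_subset (s₁ := {0, p})]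
  · rw [Finset.sum_pair hp.ne_zero.symm]
    simp [mul_add_one, add_comm]
  · intro k hk
    simp only [Finset.mem_insert, Finset.mem_singleton] at hk
    rw [Finset.mem_range, mul_add_one]
    rcases hk with rfl | rfl <;> omega
  · intro k hk hk'
    simp only [Finset.mem_insert, Finset.mem_singleton, not_or] at hk'
    rw [Finset.mem_range_succ_iff] at hk
    rw [ZMod.natCast_eq_zero_iff, sq]
    rcases lt_or_ge p k with hlt | hle
    · simp [Nat.choose_eq_zero_of_lt hlt]
    · have hkp : k < p := lt_of_le_of_ne hle hk'.2
      refine mul_dvd_mul (hp.dvd_choose_self hk'.1 hkp) (hp.dvd_mul_choose_of_not_dvd a ?_)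
      intro h
      have hdvd : p ∣ k := (Nat.dvd_sub_iff_right hk (dvd_mul_right _ _)).1 h
      exact Nat.not_dvd_of_pos_of_lt (Nat.pos_of_ne_zero hk'.1) hkp hdvd

/-- For any prime p and a, b ≥ 0, C(pa, pb) ≡ C(a,b) (mod p²). -/
theorem jacobsthal_ljunggren_sq (p : ℕ) (hp : p.Prime) (a b : ℕ) :
    (p * a).choose (p * b) ≡ a.choose b [MOD p ^ 2] := by
  induction a generalizing b with
  | zero =>
    rcases b with _ | b
    · simp [Nat.ModEq.refl]
    · rw [mul_zero, Nat.choose_eq_zero_of_lt (Nat.mul_pos hp.pos b.succ_pos),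
        Nat.choose_zero_succ]
  | succ a ih =>
    rcases b with _ | b
    · simp [Nat.ModEq.refl]
    · rw [Nat.choose_succ_succ]
      exact (hp.choose_mul_succ_modEq a b).trans ((ih b).add (ih (b + 1)))
end
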